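/- arXiv:2212.13862 — 9 statements merged into one kernel-verified Lean document; each statement's English description precedes it below -/
import Mathlib

section
/- Let d ≥ 1 and let v₀, …, v_d ∈ ℝ^d be affinely independent points, so that S = conv{v₀, …, v_d} is a d-dimensional simplex. Let P be a point of the interior of S with P ≠ 0, and set λ = sSup{t ∈ ℝ : t • P ∈ S}. Then λ > 1, and there exists a nonempty proper subset I ⊊ {0, 1, …, d} such that λ • P lies in the relative interior (intrinsic interior) of conv{v_i : i ∈ I} and the family (v_i)_{i ∈ I} is linearly independent over ℝ. -/
/-- A point with nonnegative barycentric coordinates, all zero outside `I`, lies in the convex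
hull of the basis points indexed by `I`. -/
theorem AffineBasis.mem_convexHull_image_of_coord {ι E : Type*} [Fintype ι] [AddCommGroup E]
    [Module ℝ E] (b : AffineBasis ι ℝ E) (I : Finset ι) {x : E}
    (hnonneg : ∀ i, 0 ≤ b.coord i x) (hzero : ∀ i ∉ I, b.coord i x = 0) :
    x ∈ convexHull ℝ (b '' I) := by
  have hsum : ∑ i ∈ I, b.coord i x = 1 := by
    rw [← b.sum_coord_apply_eq_one x]
    exact Finset.sum_subset (Finset.subset_univ I) fun i _ hi => hzero i hi
  have hx : ∑ i ∈ I, b.coord i x • b i = x := by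
    conv_rhs => rw [← b.linear_combination_coord_eq_self x]
    exact Finset.sum_subset (Finset.subset_univ I) fun i _ hi => by rw [hzero i hi, zero_smul]
  rw [← hx]
  exact (convex_convexHull ℝ _).sum_mem (fun i _ => hnonneg i) hsum
    fun i hi => subset_convexHull ℝ _ ⟨i, hi, rfl⟩

/-- Barycentric coordinates outside `I` vanish on the affine span of the points indexed by `I`. -/
theorem AffineBasis.coord_eq_zero_of_mem_affineSpan_image {ι E : Type*} [AddCommGroup E]
    [Module ℝ E] (b : AffineBasis ι ℝ E) {I : Set ι} {x : E}
    (hx : x ∈ affineSpan ℝ (b '' I)) {j : ι} (hj : j ∉ I) : b.coord j x = 0 := by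
  have hle : affineSpan ℝ (b '' I) ≤ (affineSpan ℝ {(0 : ℝ)}).comap (b.coord j) := by
    rw [affineSpan_le]
    rintro _ ⟨i, hi, rfl⟩
    have hne : j ≠ i := fun h => hj (h ▸ hi)
    simp [b.coord_apply_ne hne]
  simpa using hle hx

/-- A point whose barycentric coordinates are positive on `I` and zero elsewhere lies in the
intrinsic interior of the face spanned by `I`. -/
theorem AffineBasis.mem_intrinsicInterior_convexHull_image {ι E : Type*} [Fintype ι]
    [NormedAddCommGroup E] [NormedSpace ℝ E] [FiniteDimensional ℝ E] (b : AffineBasis ι ℝ E)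
    (I : Finset ι) {x : E} (hpos : ∀ i ∈ I, 0 < b.coord i x)
    (hzero : ∀ i ∉ I, b.coord i x = 0) :
    x ∈ intrinsicInterior ℝ (convexHull ℝ (b '' I)) := by
  have hmem : ∀ y, (∀ i ∈ I, 0 < b.coord i y) → (∀ i ∉ I, b.coord i y = 0) →
      y ∈ convexHull ℝ (b '' I) := fun y hy hy0 =>
    b.mem_convexHull_image_of_coord I
      (fun i => by
        by_cases hi : i ∈ I
        · exact (hy i hi).le
        · exact (hy0 i hi).ge) hy0
  rw [mem_intrinsicInterior]
  refine ⟨⟨x, subset_affineSpan ℝ _ (hmem x hpos hzero)⟩, ?_, rfl⟩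
  rw [mem_interior]
  refine ⟨{y | ∀ i ∈ I, 0 < b.coord i (y : E)}, fun y hy => ?_, ?_, hpos⟩
  · refine hmem y hy fun i hi => ?_
    have hyspan : (y : E) ∈ affineSpan ℝ (b '' I) :=
      (affineSpan_convexHull (𝕜 := ℝ) (b '' (I : Set ι))).le y.2
    exact b.coord_eq_zero_of_mem_affineSpan_image hyspan (by simpa using hi)
  · have : {y : affineSpan ℝ (convexHull ℝ (b '' I)) | ∀ i ∈ I, 0 < b.coord i (y : E)} =
        ⋂ i ∈ I, Subtype.val ⁻¹' (b.coord i ⁻¹' Set.Ioi 0) := by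
      ext y
      simp
    rw [this]
    exact isOpen_biInter_finset fun i _ => (isOpen_Ioi.preimage
      (continuous_barycentric_coord b i)).preimage continuous_subtype_val

/-- If some barycentric coordinate outside `I` does not vanish at the origin, then the basis
points indexed by `I` are linearly independent. -/
theorem AffineBasis.linearIndependent_of_coord_zero_ne_zero {ι E : Type*} [AddCommGroup E]
    [Module ℝ E] (b : AffineBasis ι ℝ E) (I : Finset ι) {j : ι} (hj : j ∉ I)
    (h0 : b.coord j 0 ≠ 0) : LinearIndependent ℝ (fun i : I => b i) := by
  classical
  have hlin : ∀ k x, (b.coord k).linear x = b.coord k x - b.coord k 0 := fun k x => by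
    simpa using (b.coord k).linearMap_vsub x 0
  rw [Fintype.linearIndependent_iff]
  intro a ha i
  have hcoord : ∀ k, ∑ l : I, a l * (b.coord k (b l) - b.coord k 0) = 0 := fun k => by
    have h := congrArg (b.coord k).linear ha
    simp only [map_sum, map_smul, smul_eq_mul, map_zero] at h
    simpa only [hlin] using h
  have hsum : ∑ l, a l = 0 := by
    have h := hcoord j
    have hne : ∀ l : I, b.coord j (b l) = 0 := fun l =>
      b.coord_apply_ne fun h => hj (h ▸ l.2)
    simp only [hne, ← Finset.sum_mul] at h
    simpa [h0] using h
  have h := hcoord i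
  simp only [mul_sub, Finset.sum_sub_distrib, ← Finset.sum_mul, hsum, b.coord_apply] at h
  simpa [Subtype.ext_iff.symm] using h

/-- Along a ray `t ↦ t • P` with `P ≠ 0`, the parameters landing in a bounded set are bounded
above. -/
theorem Bornology.IsBounded.bddAbove_smul_mem {E : Type*} [NormedAddCommGroup E]
    [NormedSpace ℝ E] {S : Set E} (hS : Bornology.IsBounded S) {P : E} (hP : P ≠ 0) :
    BddAbove {t : ℝ | t • P ∈ S} := by
  obtain ⟨R, hR⟩ := hS.exists_norm_le
  refine ⟨R / ‖P‖, fun t ht => ?_⟩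
  rw [le_div_iff₀ (norm_pos_iff.mpr hP)]
  have h := hR _ ht
  rw [norm_smul, Real.norm_eq_abs] at h
  exact (mul_le_mul_of_nonneg_right (le_abs_self t) (norm_nonneg P)).trans h

/-- A parameter landing in the interior of `S` is smaller than the supremum of all parameters
landing in `S`. -/
theorem lt_sSup_of_smul_mem_interior {E : Type*} [NormedAddCommGroup E]
    [NormedSpace ℝ E] {S : Set E} {P : E} (hS : BddAbove {t : ℝ | t • P ∈ S}) {t : ℝ}
    (ht : t • P ∈ interior S) : t < sSup {t : ℝ | t • P ∈ S} := by
  have hopen : IsOpen {u : ℝ | u • P ∈ interior S} :=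
    isOpen_interior.preimage (by fun_prop : Continuous fun u : ℝ => u • P)
  obtain ⟨u, htu, hu⟩ := (((hopen.eventually_mem ht).filter_mono nhdsWithin_le_nhds).and
    (eventually_mem_nhdsWithin (s := Set.Ioi t))).exists
  exact lt_of_lt_of_le hu (le_csSup hS (interior_subset htu : u • P ∈ S))

/-- Let `d ≥ 1` and let `v₀, …, v_d ∈ ℝ^d` be affinely independent, so that
`S = conv{v₀, …, v_d}` is a `d`-dimensional simplex. Let `P ≠ 0` be an interior point of `S`
and `λ = sSup {t : t • P ∈ S}`. Then `λ > 1` and there is a nonempty proper subset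
`I ⊊ {0, …, d}` such that `λ • P` lies in the relative (intrinsic) interior of
`conv{v_i : i ∈ I}` and `(v_i)_{i ∈ I}` is linearly independent. -/
theorem stmt_0 (d : ℕ) (hd : 1 ≤ d) (v : Fin (d + 1) → (Fin d → ℝ))
    (hv : AffineIndependent ℝ v)
    (P : Fin d → ℝ)
    (hP : P ∈ interior (convexHull ℝ (Set.range v)))
    (hP0 : P ≠ 0) :
    1 < sSup {t : ℝ | t • P ∈ convexHull ℝ (Set.range v)} ∧
    ∃ I : Finset (Fin (d + 1)), I.Nonempty ∧ I ≠ Finset.univ ∧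
      (sSup {t : ℝ | t • P ∈ convexHull ℝ (Set.range v)}) • P ∈
        intrinsicInterior ℝ (convexHull ℝ (v '' ↑I)) ∧
      LinearIndependent ℝ (fun i : ↥I => v ↑i) := by
  let b : AffineBasis (Fin (d + 1)) ℝ (Fin d → ℝ) :=
    ⟨v, hv, affineSpan_eq_top_of_nonempty_interior ⟨P, hP⟩⟩
  have hcompact : IsCompact (convexHull ℝ (Set.range v)) :=
    (Set.finite_range v).isCompact_convexHull ℝ
  have hbdd := hcompact.isBounded.bddAbove_smul_mem hP0
  have hone : (1 : ℝ) • P ∈ interior (convexHull ℝ (Set.range v)) := by rwa [one_smul]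
  have hlt := lt_sSup_of_smul_mem_interior hbdd hone
  have hmem : sSup {t : ℝ | t • P ∈ convexHull ℝ (Set.range v)} • P ∈
      convexHull ℝ (Set.range v) :=
    IsClosed.csSup_mem
      (hcompact.isClosed.preimage (by fun_prop : Continuous fun t : ℝ => t • P))
      ⟨1, (interior_subset hone : (1 : ℝ) • P ∈ _)⟩ hbdd
  have hnot : sSup {t : ℝ | t • P ∈ convexHull ℝ (Set.range v)} • P ∉
      interior (convexHull ℝ (Set.range v)) := fun h =>
    lt_irrefl _ (lt_sSup_of_smul_mem_interior hbdd h)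
  refine ⟨hlt, ?_⟩
  generalize sSup {t : ℝ | t • P ∈ convexHull ℝ (Set.range v)} = L at hlt hmem hnot ⊢
  have hvb : v = b := rfl
  rw [hvb, b.interior_convexHull] at hP hnot
  rw [hvb, b.convexHull_eq_nonneg_coord] at hmem
  obtain ⟨j, hj⟩ : ∃ j, b.coord j (L • P) ≤ 0 := by simpa using hnot
  have hj0 : b.coord j (L • P) = 0 := le_antisymm hj (hmem j)
  have hjI : j ∉ Finset.univ.filter (fun i => 0 < b.coord i (L • P)) := by simp [hj0]
  refine ⟨Finset.univ.filter fun i => 0 < b.coord i (L • P), ?_, fun h => ?_, ?_, ?_⟩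
  · have hsum : ∑ _i : Fin (d + 1), (0 : ℝ) < ∑ i, b.coord i (L • P) := by
      rw [b.sum_coord_apply_eq_one]
      simp
    obtain ⟨i, -, hpos⟩ := Finset.exists_lt_of_sum_lt hsum
    exact ⟨i, by simpa using hpos⟩
  · rw [h] at hjI
    exact hjI (Finset.mem_univ j)
  · exact b.mem_intrinsicInterior_convexHull_image _ (fun i hi => by simpa using hi)
      fun i hi => le_antisymm (by simpa using hi) (hmem i)
  · refine b.linearIndependent_of_coord_zero_ne_zero _ hjI fun h0 => ?_
    have hlin : ∀ x, (b.coord j).linear x = b.coord j x := fun x => by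
      simpa [h0] using (b.coord j).linearMap_vsub x 0
    rw [← hlin, map_smul, smul_eq_mul, hlin] at hj0
    exact (mul_pos (one_pos.trans hlt) (hP j)).ne' hj0
end

section
/- Let 1 ≤ d' < d and let π : ℝ^d → ℝ^{d'} be a surjective linear map. Let □ ⊆ ℝ^d be a compact convex set with 0 in its interior. Set □' = π(□) ⊆ ℝ^{d'} and □₀ = □ ∩ ker π. Let γ = γ(0 ∈ □), γ' = γ(0 ∈ □'), and γ₀ = γ(0 ∈ □₀). Then γ₀ · γ' ≤ γ ≤ min(γ₀, γ'). -/
open Pointwise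

/-- The coefficient of asymmetry `γ(P ∈ K) = sSup {t ≥ 0 : P + t • (K - K) ⊆ K}`. -/
noncomputable def asym {E : Type*} [AddCommGroup E] [Module ℝ E] (K : Set E) (P : E) : ℝ :=
  sSup {t : ℝ | 0 ≤ t ∧ ∀ x ∈ K - K, P + t • x ∈ K}

/-- The parameters `t` whose supremum is `asym K 0`. -/
def asymSet {E : Type*} [AddCommGroup E] [Module ℝ E] (K : Set E) : Set ℝ :=
  {t : ℝ | 0 ≤ t ∧ ∀ x ∈ K - K, (0 : E) + t • x ∈ K}

theorem mem_asymSet_iff {E : Type*} [AddCommGroup E] [Module ℝ E] {K : Set E} {t : ℝ} :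
    t ∈ asymSet K ↔ 0 ≤ t ∧ ∀ x ∈ K, ∀ y ∈ K, t • (x - y) ∈ K := by
  simp only [asymSet, Set.mem_ofPred_eq, zero_add, Set.mem_sub]
  constructor
  · rintro ⟨h, h'⟩
    exact ⟨h, fun x hx y hy => h' _ ⟨x, hx, y, hy, rfl⟩⟩
  · rintro ⟨h, h'⟩
    refine ⟨h, ?_⟩
    rintro _ ⟨x, hx, y, hy, rfl⟩
    exact h' x hx y hy

theorem zero_mem_asymSet {E : Type*} [AddCommGroup E] [Module ℝ E] {K : Set E}
    (h0 : (0 : E) ∈ K) : (0 : ℝ) ∈ asymSet K :=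
  mem_asymSet_iff.2 ⟨le_rfl, fun x _ y _ => by simpa using h0⟩

section Normed

variable {E : Type*} [NormedAddCommGroup E] [NormedSpace ℝ E] {K : Set E}

/-- In a compact set, the ray through `-y` reaches at least as far as `t / (1 - t)`. -/
theorem exists_neg_smul_mem (hK : IsCompact K) (h0 : (0 : E) ∈ K) {y : E} (hy : y ∈ K)
    (hy0 : y ≠ 0) {t : ℝ} (ht : t ∈ asymSet K) :
    ∃ c : ℝ, 0 ≤ c ∧ (-c) • y ∈ K ∧ t ≤ c * (1 - t) := by
  obtain ⟨ht0, ht⟩ := mem_asymSet_iff.1 ht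
  obtain ⟨R, hR⟩ := hK.isBounded.exists_norm_le
  have hny : 0 < ‖y‖ := norm_pos_iff.2 hy0
  have hcont : Continuous fun c : ℝ => (-c) • y := by fun_prop
  have hC : IsCompact {c : ℝ | 0 ≤ c ∧ (-c) • y ∈ K} := by
    refine (isCompact_Icc (a := (0 : ℝ)) (b := R / ‖y‖)).of_isClosed_subset
      (isClosed_Ici.inter (hK.isClosed.preimage hcont)) ?_
    rintro c ⟨hc, hcK⟩
    refine ⟨hc, (le_div_iff₀ hny).2 ?_⟩
    simpa [norm_smul, abs_of_nonneg hc] using hR _ hcK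
  obtain ⟨c, ⟨hc, hcK⟩, hmax⟩ := hC.exists_isGreatest ⟨0, le_rfl, by simpa using h0⟩
  refine ⟨c, hc, hcK, ?_⟩
  have h := hmax (show t * (c + 1) ∈ {c : ℝ | 0 ≤ c ∧ (-c) • y ∈ K} from
    ⟨by positivity, by convert ht _ hcK _ hy using 1; module⟩)
  linarith

theorem lt_one_of_mem_asymSet (hK : IsCompact K) (h0 : (0 : E) ∈ K) (hne : ∃ y ∈ K, y ≠ 0)
    {t : ℝ} (ht : t ∈ asymSet K) : t < 1 := by
  obtain ⟨y, hy, hy0⟩ := hne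
  obtain ⟨c, hc, -, h⟩ := exists_neg_smul_mem hK h0 hy hy0 ht
  by_contra! h1
  nlinarith

theorem exists_neg_smul_eq (hK : IsCompact K) (hconv : Convex ℝ K) (h0 : (0 : E) ∈ K)
    {t : ℝ} (ht : t ∈ asymSet K) (ht1 : t < 1) {y : E} (hy : y ∈ K) :
    ∃ k ∈ K, (-t) • y = (1 - t) • k := by
  by_cases hy0 : y = 0
  · exact ⟨0, h0, by simp [hy0]⟩
  obtain ⟨c, hc, hcK, h⟩ := exists_neg_smul_mem hK h0 hy hy0 ht
  have ht0 := (mem_asymSet_iff.1 ht).1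
  have h1 : 0 < 1 - t := by linarith
  refine ⟨(-(t / (1 - t))) • y, ?_, ?_⟩
  · rcases hc.eq_or_lt with rfl | hc
    · have : t = 0 := by linarith
      simpa [this] using h0
    · have hle : t / (1 - t) ≤ c := (div_le_iff₀ h1).2 h
      have := hconv.smul_mem_of_zero_mem h0 hcK
        (t := t / (1 - t) / c) ⟨by positivity, (div_le_one hc).2 hle⟩
      convert this using 1
      rw [smul_smul]
      congr 1
      field_simp
  · rw [smul_smul]
    congr 1
    field_simp

theorem bddAbove_asymSet (hK : IsCompact K) (h0 : (0 : E) ∈ K) (hne : ∃ y ∈ K, y ≠ 0) :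
    BddAbove (asymSet K) :=
  ⟨1, fun _ ht => (lt_one_of_mem_asymSet hK h0 hne ht).le⟩

theorem exists_pos_smul_mem (h0 : (0 : E) ∈ interior K) (v : E) : ∃ ε : ℝ, 0 < ε ∧ ε • v ∈ K := by
  have hcont : Filter.Tendsto (fun ε : ℝ => ε • v) (nhdsWithin 0 (Set.Ioi 0)) (nhds 0) := by
    have : Continuous fun ε : ℝ => ε • v := by fun_prop
    simpa using (this.tendsto 0).mono_left nhdsWithin_le_nhds
  obtain ⟨ε, hεK, hε⟩ :=
    ((hcont.eventually (mem_interior_iff_mem_nhds.1 h0)).and self_mem_nhdsWithin).exists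
  exact ⟨ε, hε, hεK⟩

/-- Parameters admissible for the fibre and for the image multiply to one admissible for `K`. -/
theorem mul_mem_asymSet {F : Type*} [NormedAddCommGroup F] [NormedSpace ℝ F] {f : E →ₗ[ℝ] F}
    (hconv : Convex ℝ K) (h0 : (0 : E) ∈ K)
    (hker : IsCompact (K ∩ (LinearMap.ker f : Set E))) (himg : IsCompact (f '' K)) {t s : ℝ}
    (ht : t ∈ asymSet (K ∩ (LinearMap.ker f : Set E))) (ht1 : t < 1)
    (hs : s ∈ asymSet (f '' K)) (hs1 : s < 1) : t * s ∈ asymSet K := by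
  have ht0 := (mem_asymSet_iff.1 ht).1
  have hs0 := (mem_asymSet_iff.1 hs).1
  refine mem_asymSet_iff.2 ⟨by positivity, fun x hx y hy => ?_⟩
  obtain ⟨_, ⟨z, hz, rfl⟩, hyz⟩ := exists_neg_smul_eq himg (hconv.linear_image f)
    ⟨0, h0, map_zero f⟩ hs hs1 (Set.mem_image_of_mem f hy)
  have hw : s • y + (1 - s) • z ∈ K ∩ (LinearMap.ker f : Set E) := by
    refine ⟨hconv hy hz hs0 (by linarith) (by ring), ?_⟩
    simp only [SetLike.mem_coe, LinearMap.mem_ker, map_add, map_smul, ← hyz]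
    module
  obtain ⟨k, ⟨hk, -⟩, hwk⟩ := exists_neg_smul_eq hker
    (hconv.inter (LinearMap.ker f).convex) ⟨h0, Submodule.zero_mem _⟩ ht ht1 hw
  have hxz : s • x + (1 - s) • z ∈ K := hconv hx hz hs0 (by linarith) (by ring)
  have key : t • (s • x + (1 - s) • z) + (1 - t) • k ∈ K :=
    hconv hxz hk ht0 (by linarith) (by ring)
  convert key using 1
  rw [← hwk]
  module

end Normed

theorem sSup_mul_sSup_le {S T : Set ℝ} {g : ℝ} (hS : ∀ t ∈ S, 0 ≤ t) (hT : ∀ s ∈ T, 0 ≤ s)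
    (hg : 0 ≤ g) (h : ∀ t ∈ S, ∀ s ∈ T, t * s ≤ g) : sSup S * sSup T ≤ g := by
  have h1 : ∀ t ∈ S, t * sSup T ≤ g := by
    intro t ht
    rcases (hS t ht).eq_or_lt with rfl | htpos
    · simpa using hg
    · rw [← le_div_iff₀' htpos]
      exact Real.sSup_le (fun s hs => (le_div_iff₀' htpos).2 (h t ht s hs)) (by positivity)
  rcases (Real.sSup_nonneg hT).eq_or_lt with h0 | hpos
  · simpa [← h0] using hg
  · rw [← le_div_iff₀ hpos]
    exact Real.sSup_le (fun t ht => (le_div_iff₀ hpos).2 (h1 t ht)) (by positivity)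

/-- Let `1 ≤ d' < d`, let `π : ℝ^d → ℝ^{d'}` be surjective linear,
`□` compact convex with `0` in its interior, `□' = π(□)`, `□₀ = □ ∩ ker π`. Then
`γ₀ · γ' ≤ γ ≤ min (γ₀, γ')` where `γ = γ(0 ∈ □)`, `γ' = γ(0 ∈ □')`, `γ₀ = γ(0 ∈ □₀)`. -/
theorem stmt_1 (d d' : ℕ) (hd' : 1 ≤ d') (hdd : d' < d)
    (π : (Fin d → ℝ) →ₗ[ℝ] (Fin d' → ℝ)) (hπ : Function.Surjective π)
    (K : Set (Fin d → ℝ)) (hKc : IsCompact K) (hKconv : Convex ℝ K)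
    (h0 : (0 : Fin d → ℝ) ∈ interior K) :
    asym (K ∩ (LinearMap.ker π : Set (Fin d → ℝ))) 0 * asym (π '' K) 0 ≤ asym K 0 ∧
    asym K 0 ≤ min (asym (K ∩ (LinearMap.ker π : Set (Fin d → ℝ))) 0) (asym (π '' K) 0) := by
  have h0K : (0 : Fin d → ℝ) ∈ K := interior_subset h0
  have hcont : Continuous π := π.continuous_of_finiteDimensional
  have hker : IsCompact (K ∩ (LinearMap.ker π : Set (Fin d → ℝ))) :=
    hKc.inter_right (LinearMap.ker π).closed_of_finiteDimensional
  have himg : IsCompact (π '' K) := hKc.image hcont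
  have h0ker : (0 : Fin d → ℝ) ∈ K ∩ (LinearMap.ker π : Set (Fin d → ℝ)) :=
    ⟨h0K, Submodule.zero_mem _⟩
  have h0img : (0 : Fin d' → ℝ) ∈ π '' K := ⟨0, h0K, map_zero π⟩
  have hneker : ∃ y ∈ K ∩ (LinearMap.ker π : Set (Fin d → ℝ)), y ≠ 0 := by
    obtain ⟨v, hv, hv0⟩ := (Submodule.ne_bot_iff _).1
      (LinearMap.ker_ne_bot_of_finrank_lt (f := π) (by simpa using hdd))
    obtain ⟨ε, hε, hεK⟩ := exists_pos_smul_mem h0 v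
    exact ⟨ε • v, ⟨hεK, Submodule.smul_mem _ _ hv⟩, smul_ne_zero hε.ne' hv0⟩
  have hneimg : ∃ y ∈ π '' K, y ≠ 0 := by
    have : Nonempty (Fin d') := ⟨⟨0, hd'⟩⟩
    obtain ⟨w, hw⟩ := exists_ne (0 : Fin d' → ℝ)
    obtain ⟨v, rfl⟩ := hπ w
    obtain ⟨ε, hε, hεK⟩ := exists_pos_smul_mem h0 v
    exact ⟨π (ε • v), ⟨_, hεK, rfl⟩, by rw [map_smul]; exact smul_ne_zero hε.ne' hw⟩
  have hne : ∃ y ∈ K, y ≠ 0 := hneker.imp fun y hy => ⟨hy.1.1, hy.2⟩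
  have hbdd := bddAbove_asymSet hKc h0K hne
  change sSup (asymSet _) * sSup (asymSet _) ≤ sSup (asymSet _) ∧
    sSup (asymSet _) ≤ min (sSup (asymSet _)) (sSup (asymSet _))
  refine ⟨sSup_mul_sSup_le (fun t ht => ht.1) (fun s hs => hs.1)
    (Real.sSup_nonneg fun t ht => ht.1) fun t ht s hs => le_csSup hbdd ?_, le_min ?_ ?_⟩
  · exact mul_mem_asymSet hKconv h0K hker himg ht (lt_one_of_mem_asymSet hker h0ker hneker ht)
      hs (lt_one_of_mem_asymSet himg h0img hneimg hs)
  · refine csSup_le_csSup (bddAbove_asymSet hker h0ker hneker) ⟨0, zero_mem_asymSet h0K⟩ ?_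
    intro t ht
    obtain ⟨ht0, ht⟩ := mem_asymSet_iff.1 ht
    exact mem_asymSet_iff.2 ⟨ht0, fun x hx y hy =>
      ⟨ht x hx.1 y hy.1, Submodule.smul_mem _ _ (Submodule.sub_mem _ hx.2 hy.2)⟩⟩
  · refine csSup_le_csSup (bddAbove_asymSet himg h0img hneimg) ⟨0, zero_mem_asymSet h0K⟩ ?_
    intro t ht
    obtain ⟨ht0, ht⟩ := mem_asymSet_iff.1 ht
    refine mem_asymSet_iff.2 ⟨ht0, ?_⟩
    rintro _ ⟨x, hx, rfl⟩ _ ⟨y, hy, rfl⟩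
    exact ⟨_, ht x hx y hy, by rw [map_smul, map_sub]⟩
end

section
/- Let z ∈ ℤ, let k ∈ ℕ, and let α, β be real numbers with 0 < β ≤ α ≤ 1. Let I = [z − α, z + 2k + β] ⊆ ℝ. Then the set of integers in the interior of I is exactly {z, z+1, …, z+2k}, and the Pikhurko constant γ(ℤ, I) equals (k + β)/(2k + α + β); moreover this maximum is attained at the point P = z + k. -/
open Pointwise

/-- The Pikhurko constant `γ(ℤ, K)` of a subset of `ℝ`: the supremum of the coefficients of
asymmetry over integer points of the interior of `K`. -/
noncomputable def pik (K : Set ℝ) : ℝ :=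
  sSup (asym K '' ({x : ℝ | ∃ z : ℤ, x = (z : ℝ)} ∩ interior K))

/-- The coefficient of asymmetry of a segment with respect to one of its points. -/
theorem asym_Icc {a b P : ℝ} (hab : a < b) (ha : a ≤ P) (hb : P ≤ b) :
    asym (Set.Icc a b) P = min (P - a) (b - P) / (b - a) := by
  have hlen : 0 < b - a := sub_pos.2 hab
  have hset : {t : ℝ | 0 ≤ t ∧ ∀ x ∈ Set.Icc a b - Set.Icc a b, P + t • x ∈ Set.Icc a b}
      = Set.Icc 0 (min (P - a) (b - P) / (b - a)) := by
    ext t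
    simp only [Set.mem_ofPred_eq, Set.mem_Icc, le_div_iff₀ hlen, le_min_iff, smul_eq_mul]
    refine and_congr_right fun ht => ⟨fun h => ?_, ?_⟩
    · have h₁ := h (a - b)
        (Set.sub_mem_sub (Set.left_mem_Icc.2 hab.le) (Set.right_mem_Icc.2 hab.le))
      have h₂ := h (b - a)
        (Set.sub_mem_sub (Set.right_mem_Icc.2 hab.le) (Set.left_mem_Icc.2 hab.le))
      constructor <;> linarith [h₁.1, h₂.2]
    · rintro ⟨h₁, h₂⟩ _ ⟨x, hx, y, hy, rfl⟩
      have hu : t * (x - y) ≤ t * (b - a) := by gcongr <;> linarith [hx.2, hy.1]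
      have hl : t * (y - x) ≤ t * (b - a) := by gcongr <;> linarith [hx.1, hy.2]
      constructor <;> linarith
  rw [asym, hset, csSup_Icc]
  exact div_nonneg (le_min (sub_nonneg.2 ha) (sub_nonneg.2 hb)) hlen.le

/-- For `z ∈ ℤ`, `k ∈ ℕ`, `0 < β ≤ α ≤ 1` and `I = [z - α, z + 2k + β]`:
the integers interior to `I` are exactly `{z, …, z + 2k}`, and
`γ(ℤ, I) = (k + β)/(2k + α + β)`, attained at `P = z + k`. -/
theorem stmt_2 (z : ℤ) (k : ℕ) (α β : ℝ) (hβ : 0 < β) (hβα : β ≤ α) (hα : α ≤ 1) :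
    ({x : ℝ | ∃ n : ℤ, x = (n : ℝ)} ∩
        interior (Set.Icc ((z : ℝ) - α) ((z : ℝ) + 2 * k + β))
      = {x : ℝ | ∃ n : ℤ, z ≤ n ∧ n ≤ z + 2 * (k : ℤ) ∧ x = (n : ℝ)}) ∧
    pik (Set.Icc ((z : ℝ) - α) ((z : ℝ) + 2 * k + β)) = (k + β) / (2 * k + α + β) ∧
    asym (Set.Icc ((z : ℝ) - α) ((z : ℝ) + 2 * k + β)) ((z : ℝ) + k)
      = (k + β) / (2 * k + α + β) := by
  have hk : (0 : ℝ) ≤ k := k.cast_nonneg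
  have hab : (z : ℝ) - α < z + 2 * k + β := by linarith
  have hlen : (z : ℝ) + 2 * k + β - (z - α) = 2 * k + α + β := by ring
  have hint : {x : ℝ | ∃ n : ℤ, x = (n : ℝ)} ∩
        interior (Set.Icc ((z : ℝ) - α) ((z : ℝ) + 2 * k + β))
      = {x : ℝ | ∃ n : ℤ, z ≤ n ∧ n ≤ z + 2 * (k : ℤ) ∧ x = (n : ℝ)} := by
    rw [interior_Icc]
    ext x
    constructor
    · rintro ⟨⟨n, rfl⟩, h₁, h₂⟩
      refine ⟨n, ?_, ?_, rfl⟩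
      · have : z < n + 1 := by exact_mod_cast (by linarith : (z : ℝ) < n + 1)
        omega
      · have : n < z + 2 * (k : ℤ) + 1 := by
          exact_mod_cast (by linarith : (n : ℝ) < z + 2 * k + 1)
        omega
    · rintro ⟨n, h₁, h₂, rfl⟩
      have h₁' : (z : ℝ) ≤ n := by exact_mod_cast h₁
      have h₂' : (n : ℝ) ≤ z + 2 * k := by exact_mod_cast h₂
      exact ⟨⟨n, rfl⟩, by linarith, by linarith⟩
  have hasym : asym (Set.Icc ((z : ℝ) - α) ((z : ℝ) + 2 * k + β)) ((z : ℝ) + k)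
      = (k + β) / (2 * k + α + β) := by
    rw [asym_Icc hab (by linarith) (by linarith), hlen, min_eq_right (by linarith)]
    congr 1
    ring
  refine ⟨hint, ?_, hasym⟩
  rw [pik, hint]
  refine IsGreatest.csSup_eq ⟨⟨z + k, ⟨z + k, by omega, by omega, by push_cast; rfl⟩, hasym⟩, ?_⟩
  rintro _ ⟨_, ⟨n, h₁, h₂, rfl⟩, rfl⟩
  have h₁' : (z : ℝ) ≤ n := by exact_mod_cast h₁
  have h₂' : (n : ℝ) ≤ z + 2 * k := by exact_mod_cast h₂
  rw [asym_Icc hab (by linarith) (by linarith), hlen]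
  refine div_le_div_of_nonneg_right ?_ (by linarith)
  rcases lt_or_ge n (z + k) with h | h
  · have h' : (n : ℝ) + 1 ≤ z + k := by exact_mod_cast h
    exact (min_le_left _ _).trans (by linarith)
  · have h' : (z : ℝ) + k ≤ n := by exact_mod_cast h
    exact (min_le_right _ _).trans (by linarith)
end

section
/- Let I ⊆ ℝ be a compact interval such that ℤ ∩ interior I ≠ ∅, and let γ = γ(ℤ, I) be its Pikhurko constant. Then (1 − 2γ) · length(I) ≤ 1, where length(I) := sSup I − sInf I. -/
open Pointwise

theorem le_half_of_forall_add_smul_mem_Icc {a b p t : ℝ} (hab : a < b)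
    (ht : ∀ x ∈ Set.Icc a b - Set.Icc a b, p + t • x ∈ Set.Icc a b) : t ≤ 1 / 2 := by
  have ha : a ∈ Set.Icc a b := Set.left_mem_Icc.2 hab.le
  have hb : b ∈ Set.Icc a b := Set.right_mem_Icc.2 hab.le
  have h₁ := (ht _ (Set.sub_mem_sub hb ha)).2
  have h₂ := (ht _ (Set.sub_mem_sub ha hb)).1
  simp only [smul_eq_mul] at h₁ h₂
  nlinarith

theorem asym_Icc_le_half {a b p : ℝ} (hab : a < b) : asym (Set.Icc a b) p ≤ 1 / 2 :=
  Real.sSup_le (fun _ ht => le_half_of_forall_add_smul_mem_Icc hab ht.2) (by norm_num)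

theorem le_asym_Icc {a b p : ℝ} (hab : a < b) (hp : |p - (a + b) / 2| ≤ (b - a) / 2) :
    1 / 2 - |p - (a + b) / 2| / (b - a) ≤ asym (Set.Icc a b) p := by
  have hL : 0 < b - a := sub_pos.2 hab
  refine le_csSup ⟨1 / 2, fun t ht => le_half_of_forall_add_smul_mem_Icc hab ht.2⟩ ?_
  set d := |p - (a + b) / 2| with hd
  have hnonneg : 0 ≤ 1 / 2 - d / (b - a) := by
    rw [sub_nonneg, div_le_iff₀ hL]
    linarith
  refine ⟨hnonneg, ?_⟩
  rintro _ ⟨x, hx, y, hy, rfl⟩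
  have hmul : (1 / 2 - d / (b - a)) * (b - a) = (b - a) / 2 - d := by
    field_simp
  have h₁ := mul_le_mul_of_nonneg_left (show x - y ≤ b - a by linarith [hx.2, hy.1]) hnonneg
  have h₂ := mul_le_mul_of_nonneg_left (show -(b - a) ≤ x - y by linarith [hx.1, hy.2]) hnonneg
  have h₃ := le_abs_self (p - (a + b) / 2)
  have h₄ := neg_abs_le (p - (a + b) / 2)
  simp only [smul_eq_mul, Set.mem_Icc]
  constructor <;> linarith

theorem asym_Icc_le_pik {a b : ℝ} (hab : a < b) {z : ℤ}
    (hz : (z : ℝ) ∈ interior (Set.Icc a b)) :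
    asym (Set.Icc a b) (z : ℝ) ≤ pik (Set.Icc a b) := by
  refine le_csSup ⟨1 / 2, ?_⟩ ⟨_, ⟨⟨z, rfl⟩, hz⟩, rfl⟩
  rintro _ ⟨p, -, rfl⟩
  exact asym_Icc_le_half hab

theorem one_sub_two_mul_pik_Icc_mul_le_one {a b : ℝ}
    (hz : ∃ z : ℤ, (z : ℝ) ∈ interior (Set.Icc a b)) :
    (1 - 2 * pik (Set.Icc a b)) * (b - a) ≤ 1 := by
  obtain ⟨w, hw⟩ := hz
  rw [interior_Icc] at hw
  have hab : a < b := hw.1.trans hw.2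
  have hL : 0 < b - a := sub_pos.2 hab
  have hwd : |(w : ℝ) - (a + b) / 2| < (b - a) / 2 :=
    abs_lt.2 ⟨by linarith [hw.1], by linarith [hw.2]⟩
  have hrw := round_le ((a + b) / 2) w
  have hhalf := abs_sub_round ((a + b) / 2)
  set z : ℤ := round ((a + b) / 2)
  rw [abs_sub_comm, abs_sub_comm _ (w : ℝ)] at hrw
  rw [abs_sub_comm] at hhalf
  have hzd := hrw.trans_lt hwd
  have hz : (z : ℝ) ∈ interior (Set.Icc a b) := by
    rw [interior_Icc]
    exact ⟨by linarith [(abs_lt.1 hzd).1], by linarith [(abs_lt.1 hzd).2]⟩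
  have hle := (le_asym_Icc hab hzd.le).trans (asym_Icc_le_pik hab hz)
  have hmul := mul_le_mul_of_nonneg_right hle hL.le
  rw [sub_mul, div_mul_cancel₀ _ hL.ne'] at hmul
  linarith

/-- Let `I ⊆ ℝ` be a compact interval (i.e. a nonempty compact convex set)
with an integer in its interior, and let `γ = γ(ℤ, I)` be its Pikhurko constant. Then
`(1 - 2γ) · length I ≤ 1`, where `length I = sSup I - sInf I`. -/
theorem stmt_4 (I : Set ℝ) (hc : IsCompact I) (hconv : Convex ℝ I) (hne : I.Nonempty)
    (hz : ∃ z : ℤ, (z : ℝ) ∈ interior I) :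
    (1 - 2 * pik I) * (sSup I - sInf I) ≤ 1 := by
  have hI : I = Set.Icc (sInf I) (sSup I) :=
    eq_Icc_of_connected_compact ⟨hne, hconv.isPreconnected⟩ hc
  have hz' : ∃ z : ℤ, (z : ℝ) ∈ interior (Set.Icc (sInf I) (sSup I)) := hI ▸ hz
  have h := one_sub_two_mul_pik_Icc_mul_le_one hz'
  rwa [← hI] at h
end

section
/- Let A ⊆ (0, ∞) be a set satisfying ACC. Then there exists a real number c > 0 such that: for every compact interval I ⊆ ℝ with 0 ∈ I, with ℤ ∩ interior I ≠ ∅, and with each of the two endpoints of I belonging to the set {0} ∪ {1/a : a ∈ A} ∪ {−1/a : a ∈ A}, one has γ(ℤ, I) ≥ c. -/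
open Pointwise

/-- A set of reals satisfies the ascending chain condition if it admits no strictly
increasing sequence. -/
def ACCSet (A : Set ℝ) : Prop := ¬ ∃ f : ℕ → ℝ, StrictMono f ∧ ∀ n, f n ∈ A

/-- A nonempty subset of a set satisfying ACC has a greatest element. -/
theorem ACCSet.exists_isGreatest {A B : Set ℝ} (hA : ACCSet A) (hBA : B ⊆ A)
    (hB : B.Nonempty) : ∃ m, IsGreatest B m := by
  by_contra! h
  have : Nonempty B := hB.to_subtype
  have : NoMaxOrder B := ⟨fun x => by
    by_contra! hx
    exact h x ⟨x.2, fun y hy => hx ⟨y, hy⟩⟩⟩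
  obtain ⟨f, hf⟩ := Nat.exists_strictMono B
  exact hA ⟨fun n => f n, fun _ _ hij => hf hij, fun n => hBA (f n).2⟩

/-- The reciprocals of a set of positive numbers satisfying ACC are bounded away from `0`, and
those exceeding `1` are bounded away from `1`. -/
theorem ACCSet.exists_gap_inv {A : Set ℝ} (hA : A ⊆ Set.Ioi 0) (hACC : ACCSet A) :
    ∃ δ : ℝ, 0 < δ ∧ δ ≤ 1 ∧ ∀ x ∈ A, δ ≤ 1 / x ∧ (1 < 1 / x → 1 + δ ≤ 1 / x) := by
  obtain ⟨δ₁, h₁, H₁⟩ : ∃ δ : ℝ, 0 < δ ∧ ∀ x ∈ A, δ ≤ 1 / x := by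
    rcases A.eq_empty_or_nonempty with h | h
    · exact ⟨1, one_pos, by simp [h]⟩
    · obtain ⟨m, hm, hmax⟩ := hACC.exists_isGreatest subset_rfl h
      exact ⟨1 / m, one_div_pos.2 (hA hm),
        fun x hx => one_div_le_one_div_of_le (hA hx) (hmax hx)⟩
  obtain ⟨δ₂, h₂, H₂⟩ : ∃ δ : ℝ, 0 < δ ∧ ∀ x ∈ A, 1 < 1 / x → 1 + δ ≤ 1 / x := by
    have key : ∀ x ∈ A, 1 < 1 / x → x < 1 := fun x hx h => by
      rwa [lt_div_iff₀ (hA hx), one_mul] at h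
    rcases {x ∈ A | x < 1}.eq_empty_or_nonempty with h | h
    · refine ⟨1, one_pos, fun x hx h1 => ?_⟩
      have : x ∈ {x ∈ A | x < 1} := ⟨hx, key x hx h1⟩
      simp [h] at this
    · obtain ⟨m, hm, hmax⟩ := hACC.exists_isGreatest (Set.sep_subset _ _) h
      refine ⟨1 / m - 1, sub_pos.2 (one_lt_one_div (hA hm.1) hm.2), fun x hx h1 => ?_⟩
      have := one_div_le_one_div_of_le (hA hx) (hmax ⟨hx, key x hx h1⟩)
      linarith
  refine ⟨min 1 (min δ₁ δ₂), by positivity, min_le_left _ _, fun x hx => ⟨?_, fun h => ?_⟩⟩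
  · exact ((min_le_right _ _).trans (min_le_left _ _)).trans (H₁ x hx)
  · have := H₂ x hx h
    have : min 1 (min δ₁ δ₂) ≤ δ₂ := (min_le_right _ _).trans (min_le_right _ _)
    linarith

theorem mem_upperBounds_asym_Icc {a b P : ℝ} (hab : a < b) (hP : a ≤ P) :
    (1 : ℝ) ∈ upperBounds {t : ℝ | 0 ≤ t ∧ ∀ x ∈ Set.Icc a b - Set.Icc a b,
      P + t • x ∈ Set.Icc a b} := by
  rintro t ⟨-, ht⟩
  have := (ht (b - a) (Set.sub_mem_sub (Set.right_mem_Icc.2 hab.le)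
    (Set.left_mem_Icc.2 hab.le))).2
  rw [smul_eq_mul] at this
  by_contra! h
  nlinarith

theorem le_asym_Icc_s6 {a b P c : ℝ} (hab : a < b) (hc : 0 ≤ c)
    (h₁ : c * (b - a) ≤ P - a) (h₂ : c * (b - a) ≤ b - P) : c ≤ asym (Set.Icc a b) P := by
  have hP : a ≤ P := by nlinarith
  refine le_csSup ⟨1, mem_upperBounds_asym_Icc hab hP⟩ ⟨hc, ?_⟩
  rintro _ ⟨x, hx, y, hy, rfl⟩
  have hu : c * (x - y) ≤ c * (b - a) :=
    mul_le_mul_of_nonneg_left (by linarith [hx.2, hy.1]) hc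
  have hl : c * (y - x) ≤ c * (b - a) :=
    mul_le_mul_of_nonneg_left (by linarith [hx.1, hy.2]) hc
  simp only [smul_eq_mul, Set.mem_Icc]
  constructor <;> linarith

theorem le_pik_Icc {a b c : ℝ} (z : ℤ) (hab : a < b) (hc : 0 < c)
    (h₁ : c * (b - a) ≤ z - a) (h₂ : c * (b - a) ≤ b - z) : c ≤ pik (Set.Icc a b) := by
  have hpos : 0 < c * (b - a) := mul_pos hc (sub_pos.2 hab)
  refine (le_asym_Icc_s6 hab hc.le h₁ h₂).trans (le_csSup ⟨1, ?_⟩ ⟨z, ⟨⟨z, rfl⟩, ?_⟩, rfl⟩)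
  · rintro _ ⟨P, ⟨-, hP⟩, rfl⟩
    exact Real.sSup_le (mem_upperBounds_asym_Icc hab (interior_subset hP).1) zero_le_one
  · rw [interior_Icc]
    constructor <;> linarith

/-- Let `A ⊆ (0, ∞)` satisfy ACC. Then there is `c > 0` such that every
compact interval `I = [a, b]` containing `0`, containing an integer in its interior, and whose
endpoints lie in `{0} ∪ {±1/x : x ∈ A}`, satisfies `γ(ℤ, I) ≥ c`. -/
theorem stmt_6 (A : Set ℝ) (hA : A ⊆ Set.Ioi 0) (hACC : ACCSet A) :
    ∃ c : ℝ, 0 < c ∧ ∀ a b : ℝ, a ≤ b → (0 : ℝ) ∈ Set.Icc a b →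
      (∃ z : ℤ, (z : ℝ) ∈ interior (Set.Icc a b)) →
      (a = 0 ∨ (∃ x ∈ A, a = 1 / x) ∨ (∃ x ∈ A, a = -(1 / x))) →
      (b = 0 ∨ (∃ x ∈ A, b = 1 / x) ∨ (∃ x ∈ A, b = -(1 / x))) →
      c ≤ pik (Set.Icc a b) := by
  obtain ⟨δ, hδ, hδ1, H⟩ := hACC.exists_gap_inv hA
  refine ⟨δ / 4, by positivity, fun a b _ h0 hz ha hb => ?_⟩
  obtain ⟨z, hz⟩ := hz
  rw [interior_Icc] at hz
  have hab : a < b := hz.1.trans hz.2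
  have hinv : ∀ x ∈ A, 0 < 1 / x := fun x hx => one_div_pos.2 (hA hx)
  replace hb : b = 0 ∨ δ ≤ b ∧ (1 < b → 1 + δ ≤ b) := by
    rcases hb with h | ⟨x, hx, rfl⟩ | ⟨x, hx, rfl⟩
    · exact .inl h
    · exact .inr (H x hx)
    · linarith [h0.2, hinv x hx]
  replace ha : a = 0 ∨ δ ≤ -a ∧ (1 < -a → 1 + δ ≤ -a) := by
    rcases ha with h | ⟨x, hx, rfl⟩ | ⟨x, hx, rfl⟩
    · exact .inl h
    · linarith [h0.1, hinv x hx]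
    · rw [neg_neg]
      exact .inr (H x hx)
  rcases le_or_gt 4 (b - a) with hL | hL
  · have h₁ := Int.floor_le ((a + b) / 2)
    have h₂ := Int.lt_floor_add_one ((a + b) / 2)
    have h₃ : δ / 4 * (b - a) ≤ 1 / 4 * (b - a) :=
      mul_le_mul_of_nonneg_right (by linarith) (by linarith)
    exact le_pik_Icc ⌊(a + b) / 2⌋ hab (by positivity) (by linarith) (by linarith)
  have hle : δ / 4 * (b - a) ≤ δ := by nlinarith
  rcases ha with rfl | ha
  · have hz1 : (1 : ℝ) ≤ z := by
      have : 0 < z := by exact_mod_cast hz.1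
      exact_mod_cast this
    rcases hb with rfl | hb
    · exact absurd hab (lt_irrefl _)
    have := hb.2 (hz1.trans_lt hz.2)
    exact le_pik_Icc 1 hab (by positivity) (by push_cast; linarith) (by push_cast; linarith)
  rcases hb with rfl | hb
  · have hz1 : (z : ℝ) ≤ -1 := by
      have : z < 0 := by exact_mod_cast hz.2
      have : z ≤ -1 := by omega
      exact_mod_cast this
    have := ha.2 (by linarith [hz.1])
    exact le_pik_Icc (-1) hab (by positivity) (by push_cast; linarith) (by push_cast; linarith)
  · exact le_pik_Icc 0 hab (by positivity) (by push_cast; linarith [ha.1])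
      (by push_cast; linarith [hb.1])
end

section
/- Fix d ≥ 1, a set A ⊆ (0, ∞) satisfying ACC, and ε > 0. Then there exists a real number c > 0 with the following property: for every compact polytope □ = conv(F) ⊆ ℝ^d, where F is a finite set, such that □ has nonempty interior, 0 ∈ □, every nonzero extremal point of □ is of the form (1/a) • e with e ∈ ℤ^d primitive and a ∈ A, ℤ^d ∩ interior □ ≠ ∅, and such that for every nonzero v ∈ ℤ^d and every t with 0 < t < ε one has v ∉ t • (□ − □), the coefficient of asymmetry satisfies γ(P ∈ □) ≥ c for EVERY point P ∈ ℤ^d ∩ interior □. -/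
open Pointwise

/-- The integer lattice `ℤ^d` inside `ℝ^d`. -/
def intLat (d : ℕ) : Set (Fin d → ℝ) := {x | ∀ i, ∃ z : ℤ, x i = (z : ℝ)}

/-- A vector of `ℤ^d` is primitive if it is nonzero and the gcd of its coordinates is `1`. -/
def Primitive {d : ℕ} (e : Fin d → ℤ) : Prop :=
  e ≠ 0 ∧ Finset.univ.gcd (fun i => (e i).natAbs) = 1

/-- **Simultaneous Dirichlet approximation.** -/
theorem exists_nat_mul_near_int {d : ℕ} (y : Fin d → ℝ) {m : ℕ} (hm : 0 < m) :
    ∃ k : ℕ, 0 < k ∧ k ≤ m ^ d ∧ ∃ z : Fin d → ℤ, ∀ i, |k * y i - z i| ≤ 1 / m := by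
  have hm' : (0 : ℝ) < m := by exact_mod_cast hm
  have hbox : ∀ x : ℝ, ⌊(m : ℝ) * Int.fract x⌋₊ < m := fun x => by
    rw [Nat.floor_lt (by positivity)]
    nlinarith [Int.fract_lt_one x]
  obtain ⟨j, k, hjk, hbox_eq⟩ := Fintype.exists_ne_map_eq_of_card_lt
    (fun (j : Fin (m ^ d + 1)) (i : Fin d) => (⟨_, hbox (j * y i)⟩ : Fin m)) (by simp)
  wlog hlt : j < k generalizing j k
  · exact this k j hjk.symm hbox_eq.symm (lt_of_le_of_ne (not_lt.1 hlt) hjk.symm)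
  have hlt' : (j : ℕ) < k := hlt
  refine ⟨k - j, by omega, by omega, fun i => ⌊(k : ℝ) * y i⌋ - ⌊(j : ℝ) * y i⌋, fun i => ?_⟩
  have heq : ⌊(m : ℝ) * Int.fract ((j : ℕ) * y i)⌋₊ = ⌊(m : ℝ) * Int.fract ((k : ℕ) * y i)⌋₊ :=
    congrArg Fin.val (congrFun hbox_eq i)
  have hj1 := Nat.floor_le (a := (m : ℝ) * Int.fract ((j : ℕ) * y i)) (by positivity)
  have hj2 := Nat.lt_floor_add_one ((m : ℝ) * Int.fract ((j : ℕ) * y i))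
  have hk1 := Nat.floor_le (a := (m : ℝ) * Int.fract ((k : ℕ) * y i)) (by positivity)
  have hk2 := Nat.lt_floor_add_one ((m : ℝ) * Int.fract ((k : ℕ) * y i))
  rw [heq] at hj1 hj2
  simp only [Int.fract] at hj1 hj2 hk1 hk2
  push_cast [Nat.cast_sub hlt'.le]
  rw [abs_le, neg_le, le_div_iff₀ hm', le_div_iff₀ hm']
  constructor <;> nlinarith

/-- A convex set containing short segments along the coordinate axes contains a cube. -/
theorem mem_smul_of_abs_le {d : ℕ} (hd : 1 ≤ d) {C : Set (Fin d → ℝ)} (hC : Convex ℝ C) {M : ℝ}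
    (hM : 0 < M) (haxis : ∀ i s, |s| ≤ 1 / M → Pi.single i s ∈ C) {δ : ℝ} (hδ : 0 < δ)
    {r : Fin d → ℝ} (hr : ∀ i, |r i| ≤ δ) : r ∈ (d * M * δ) • C := by
  have hd' : (0 : ℝ) < d := by exact_mod_cast hd
  refine ⟨∑ i, (1 / (d : ℝ)) • Pi.single i (r i / (M * δ)), ?_, ?_⟩
  · refine hC.sum_mem (fun _ _ => by positivity) (by simp [hd'.ne']) fun i _ => haxis i _ ?_
    rw [abs_div, abs_of_pos (mul_pos hM hδ), div_le_div_iff₀ (by positivity) hM]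
    nlinarith [hr i]
  · ext j
    simp only [Pi.smul_apply, Finset.sum_apply, smul_eq_mul, Pi.single_apply, mul_ite, mul_zero,
      Finset.sum_ite_eq, Finset.mem_univ, if_true]
    field_simp

/-- Points of the lattice `L` avoid the dilations of `K - K` by factors below `ε`. -/
def AvoidsSmallDilations {E : Type*} [AddCommGroup E] [Module ℝ E] (L : AddSubgroup E)
    (ε : ℝ) (K : Set E) : Prop :=
  ∀ v ∈ L, v ≠ 0 → ∀ t : ℝ, 0 < t → t < ε → v ∉ t • (K - K)

section LatticeBounds

variable {d : ℕ} {K : Set (Fin d → ℝ)} {M ε : ℝ} {L : AddSubgroup (Fin d → ℝ)}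

theorem single_mem_sub (hK : Convex ℝ K) (h0 : 0 ∈ K) (hM : 0 < M)
    (haxis : ∀ i, Pi.single i (1 / M) ∈ K) (i : Fin d) (s : ℝ) (hs : |s| ≤ 1 / M) :
    Pi.single i s ∈ K - K := by
  have key : ∀ u : ℝ, 0 ≤ u → u ≤ 1 / M → Pi.single i u ∈ K := fun u hu hu' => by
    have h := hK.smul_mem_of_zero_mem h0 (haxis i) (t := u * M)
      ⟨by positivity, by rwa [le_div_iff₀ hM] at hu'⟩
    rwa [← Pi.single_smul, smul_eq_mul, mul_assoc, mul_one_div_cancel hM.ne', mul_one] at h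
  rcases le_total 0 s with h | h
  · rw [abs_of_nonneg h] at hs
    exact ⟨_, key s h hs, 0, h0, sub_zero _⟩
  · rw [abs_of_nonpos h] at hs
    exact ⟨0, h0, _, key (-s) (by linarith) hs, by simp [← Pi.single_neg]⟩

/-- The denominators of the points of a lattice `L ⊇ ℤ^d` are bounded. -/
theorem exists_common_denominator (d : ℕ) (hd : 1 ≤ d) (M ε : ℝ) (hM : 0 < M) (hε : 0 < ε) :
    ∃ N : ℕ, 0 < N ∧ ∀ (K : Set (Fin d → ℝ)) (L : AddSubgroup (Fin d → ℝ)), Convex ℝ K → 0 ∈ K →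
      (∀ i, Pi.single i (1 / M) ∈ K) → (∀ z : Fin d → ℤ, (fun i => (z i : ℝ)) ∈ L) →
      AvoidsSmallDilations L ε K →
      ∀ w ∈ L, ∃ z : Fin d → ℤ, ∀ i, (N : ℝ) * w i = z i := by
  have hd' : (0 : ℝ) < d := by exact_mod_cast hd
  obtain ⟨n, hn⟩ := exists_nat_gt (d * M / ε)
  have hn0 : (0 : ℝ) < n := lt_trans (by positivity) hn
  refine ⟨(n ^ d).factorial, Nat.factorial_pos _, fun K L hK h0 haxis hZ hL w hw => ?_⟩
  obtain ⟨k, hk0, hk, z, hz⟩ := exists_nat_mul_near_int w (m := n) (by exact_mod_cast hn0)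
  have hmem : (fun i => (k : ℝ) * w i - z i) ∈ L := by
    have := L.sub_mem (L.nsmul_mem hw k) (hZ z)
    convert this using 1
    ext i
    simp
  have hzero : (fun i => (k : ℝ) * w i - z i) = 0 := by
    by_contra hne
    refine hL _ hmem hne (d * M * (1 / n)) (by positivity) ?_
      (mem_smul_of_abs_le hd (hK.sub hK) hM (single_mem_sub hK h0 hM haxis) (by positivity) hz)
    rw [div_lt_iff₀ hε] at hn
    rw [mul_one_div, div_lt_iff₀ hn0]
    linarith
  obtain ⟨q, hq⟩ := Nat.dvd_factorial hk0 hk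
  refine ⟨fun i => q * z i, fun i => ?_⟩
  have := congrFun hzero i
  simp only [Pi.zero_apply, sub_eq_zero] at this
  rw [hq]
  push_cast
  rw [← this]
  ring

/-- The sets `K` are uniformly bounded. -/
theorem exists_abs_le (d : ℕ) (hd : 1 ≤ d) (M ε : ℝ) (hM : 0 < M) (hε : 0 < ε) :
    ∃ R : ℝ, 0 < R ∧ ∀ (K : Set (Fin d → ℝ)) (L : AddSubgroup (Fin d → ℝ)), Convex ℝ K → 0 ∈ K →
      (∀ i, Pi.single i (1 / M) ∈ K) → (∀ z : Fin d → ℤ, (fun i => (z i : ℝ)) ∈ L) →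
      AvoidsSmallDilations L ε K → ∀ x ∈ K, ‖x‖ ≤ R := by
  have hd' : (0 : ℝ) < d := by exact_mod_cast hd
  obtain ⟨n, hn⟩ := exists_nat_gt (max 2 (4 * (d * M) / ε))
  obtain ⟨hn2, hn⟩ := max_lt_iff.1 hn
  have hn0 : (0 : ℝ) < n := by linarith
  refine ⟨4 * n ^ d / ε, by positivity, fun K L hK h0 haxis hZ hL x hx => ?_⟩
  by_contra! hlarge
  have hX : 0 < ‖x‖ := lt_trans (by positivity) hlarge
  have : Nonempty (Fin d) := ⟨⟨0, hd⟩⟩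
  obtain ⟨i, hi⟩ : ∃ i, ‖x‖ = |x i| := by
    obtain ⟨i, -, hi⟩ := Finset.exists_mem_eq_sup Finset.univ Finset.univ_nonempty
      (fun i => ‖x i‖₊)
    exact ⟨i, by rw [Pi.norm_def, hi]; simp⟩
  obtain ⟨k, hk0, hk, z, hz⟩ := exists_nat_mul_near_int (fun i => x i / ‖x‖) (m := n)
    (by exact_mod_cast hn0)
  have hk1 : (1 : ℝ) ≤ k := by exact_mod_cast hk0
  have hkn : (k : ℝ) ≤ n ^ d := by exact_mod_cast hk
  have hz0 : (fun i => (z i : ℝ)) ≠ 0 := fun h => by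
    have h1 := hz i
    have h2 : (z i : ℝ) = 0 := congrFun h i
    rw [h2, sub_zero, abs_mul, abs_div, ← hi, abs_of_pos hX, div_self hX.ne', Nat.abs_cast,
      le_div_iff₀ hn0] at h1
    nlinarith
  have hcube := mem_smul_of_abs_le hd (hK.sub hK) hM (single_mem_sub hK h0 hM haxis)
    (r := fun i => z i - k * (x i / ‖x‖)) (δ := 1 / n) (by positivity)
    (fun i => by rw [abs_sub_comm]; exact hz i)
  have hray : ((k : ℝ) / ‖x‖) • x ∈ ((k : ℝ) / ‖x‖) • (K - K) :=
    Set.smul_mem_smul_set ⟨x, hx, 0, h0, sub_zero _⟩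
  have hsum := Set.add_mem_add hray hcube
  rw [← (hK.sub hK).add_smul (by positivity) (by positivity)] at hsum
  refine hL _ (hZ z) hz0 (k / ‖x‖ + d * M * (1 / n)) (by positivity) ?_ ?_
  · have h1 : (k : ℝ) / ‖x‖ < ε / 4 := by
      rw [div_lt_iff₀ hε] at hlarge
      rw [div_lt_div_iff₀ hX (by norm_num)]
      linarith
    have h2 : d * M * (1 / n) < ε / 4 := by
      rw [div_lt_iff₀ hε] at hn
      rw [mul_one_div, div_lt_div_iff₀ hn0 (by norm_num)]
      linarith
    linarith
  · convert hsum using 1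
    ext j
    simp only [Pi.add_apply, Pi.smul_apply, smul_eq_mul]
    ring

end LatticeBounds

/-- The polytope spanned by the origin and the points `b g • g`. -/
def rayHull {E : Type*} [AddCommGroup E] [Module ℝ E] {G : Finset E} (b : G → ℝ) : Set E :=
  convexHull ℝ (insert 0 (Set.range fun g : G => b g • (g : E)))

theorem rayHull_mono {E : Type*} [AddCommGroup E] [Module ℝ E] {G : Finset E} {b b' : G → ℝ}
    (hb : ∀ g, 0 ≤ b g) (hbb' : b ≤ b') : rayHull b ⊆ rayHull b' := by
  have h0 : (0 : E) ∈ rayHull b' := subset_convexHull ℝ _ (Set.mem_insert _ _)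
  refine convexHull_min ?_ (convex_convexHull ℝ _)
  rintro _ (rfl | ⟨g, rfl⟩)
  · exact h0
  · rcases (hb g).eq_or_lt with h | h
    · simpa [← h] using h0
    · have hg : b' g • (g : E) ∈ rayHull b' :=
        subset_convexHull ℝ _ (Set.mem_insert_of_mem _ ⟨g, rfl⟩)
      have h' : 0 < b' g := h.trans_le (hbb' g)
      have := (convex_convexHull ℝ _).smul_mem_of_zero_mem h0 hg (t := b g / b' g)
        ⟨by positivity, (div_le_one h').2 (hbb' g)⟩
      rwa [smul_smul, div_mul_cancel₀ _ h'.ne'] at this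

/-- If the coefficients range over a well-ordered set, the points interior to bounded polytopes
`rayHull b` are uniformly interior. -/
theorem exists_uniform_asymmetry {E : Type*} [NormedAddCommGroup E] [NormedSpace ℝ E]
    (G : Finset E) (B : Set ℝ) (hB : ∀ x ∈ B, 0 ≤ x) [WellFoundedLT B] (p : E) (R : ℝ)
    (hR : 0 < R) :
    ∃ c : ℝ, 0 < c ∧ ∀ b : G → ℝ, (∀ g, b g ∈ B) → (∀ x ∈ rayHull b, ‖x‖ ≤ R) →
      p ∈ interior (rayHull b) → ∀ x ∈ rayHull b, ∀ y ∈ rayHull b, p + c • (x - y) ∈ rayHull b := by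
  by_contra! hcon
  choose b hbB hbR hp x hx y hy hxy using fun n : ℕ => hcon (1 / (n + 1)) (by positivity)
  obtain ⟨φ, hφ⟩ := (wellQuasiOrdered_le (α := G → B)).exists_monotone_subseq
    (fun n g => ⟨b n g, hbB n g⟩)
  obtain ⟨r, hr, hball⟩ := Metric.isOpen_iff.1 isOpen_interior _ (hp (φ 0))
  obtain ⟨n, hn⟩ := exists_nat_gt (2 * R / r)
  refine hxy (φ n) (rayHull_mono (fun g => hB _ (hbB _ g)) (fun g => hφ 0 n n.zero_le g) ?_)
  refine interior_subset (hball ?_)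
  have hφn : (n : ℝ) ≤ φ n := by exact_mod_cast φ.strictMono.le_apply
  have hnorm : ‖x (φ n) - y (φ n)‖ ≤ 2 * R := by
    linarith [norm_sub_le (x (φ n)) (y (φ n)), hbR _ _ (hx (φ n)), hbR _ _ (hy (φ n))]
  rw [mem_ball_iff_norm, add_sub_cancel_left, norm_smul, Real.norm_of_nonneg (by positivity),
    one_div_mul_eq_div, div_lt_iff₀ (by positivity)]
  rw [div_lt_iff₀ hr] at hn
  nlinarith

theorem ACCSet.wellFoundedLT {A : Set ℝ} (hA : A ⊆ Set.Ioi 0) (hACC : ACCSet A) :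
    WellFoundedLT (insert 0 ((fun a : ℝ => 1 / a) '' A) : Set ℝ) := by
  refine ⟨wellFounded_iff_isEmpty_descending_chain.2 ⟨fun ⟨f, hf⟩ => hACC ?_⟩⟩
  have hnonneg : ∀ n, 0 ≤ (f n : ℝ) := fun n => by
    rcases (f n).2 with h | ⟨a, ha, h⟩
    · exact h.ge
    · rw [← h]
      exact one_div_nonneg.2 (hA ha).le
  have hlt : ∀ n, (f (n + 1) : ℝ) < f n := hf
  have hex : ∀ n, ∃ a ∈ A, 1 / a = (f n : ℝ) := fun n => by
    rcases (f n).2 with h | h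
    · linarith [hnonneg (n + 1), hlt n]
    · exact h
  choose a ha haf using hex
  refine ⟨a, strictMono_nat_of_lt_succ fun n => ?_, ha⟩
  have := hlt n
  rw [← haf, ← haf] at this
  exact (one_div_lt_one_div (hA (ha _)) (hA (ha _))).1 this

theorem ACCSet.exists_upper_bound {A : Set ℝ} (hA : A ⊆ Set.Ioi 0) (hACC : ACCSet A) :
    ∃ M : ℝ, 0 < M ∧ ∀ a ∈ A, a ≤ M := by
  by_contra! hcon
  obtain ⟨a₀, ha₀, -⟩ := hcon 1 one_pos
  choose! g hgA hg using fun a (ha : a ∈ A) => hcon a (hA ha)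
  have hmem : ∀ n, g^[n] a₀ ∈ A := fun n => by
    induction n with
    | zero => exact ha₀
    | succ n ih => rw [Function.iterate_succ_apply']; exact hgA _ ih
  refine hACC ⟨fun n => g^[n] a₀, strictMono_nat_of_lt_succ fun n => ?_, hmem⟩
  rw [Function.iterate_succ_apply']
  exact hg _ (hmem n)

theorem le_asym {E : Type*} [NormedAddCommGroup E] [NormedSpace ℝ E] {K : Set E}
    (hK : Bornology.IsBounded K) (hnt : K.Nontrivial) {P : E} {c : ℝ} (hc : 0 ≤ c)
    (h : ∀ x ∈ K, ∀ y ∈ K, P + c • (x - y) ∈ K) : c ≤ asym K P := by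
  refine le_csSup ?_ ⟨hc, ?_⟩
  · obtain ⟨x, hx, y, hy, hxy⟩ := hnt
    obtain ⟨R, hR⟩ := hK.exists_norm_le
    have hpos : 0 < ‖x - y‖ := norm_pos_iff.2 (sub_ne_zero.2 hxy)
    refine ⟨(R + ‖P‖) / ‖x - y‖, fun t ⟨ht, htK⟩ => ?_⟩
    rw [le_div_iff₀ hpos]
    have h1 := hR _ (htK _ (Set.sub_mem_sub hx hy))
    have h2 := norm_sub_le (P + t • (x - y)) P
    rw [add_sub_cancel_left, norm_smul, Real.norm_of_nonneg ht] at h2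
    linarith
  · rintro _ ⟨x, hx, y, hy, rfl⟩
    exact h x hx y hy

theorem finite_bounded_denominator (d N : ℕ) (hN : 0 < N) (S : ℝ) :
    {g : Fin d → ℝ | (∃ z : Fin d → ℤ, ∀ i, (N : ℝ) * g i = z i) ∧ ‖g‖ ≤ S}.Finite := by
  have hN' : (0 : ℝ) < N := by exact_mod_cast hN
  refine ((Set.finite_Icc (fun _ => -⌈N * S⌉ : Fin d → ℤ) (fun _ => ⌈N * S⌉)).image
    (fun z i => (z i : ℝ) / N)).subset ?_
  rintro g ⟨⟨z, hz⟩, hg⟩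
  have hzS : ∀ i, |(z i : ℝ)| ≤ ⌈N * S⌉ := fun i => by
    rw [← hz, abs_mul, abs_of_pos hN']
    exact (mul_le_mul_of_nonneg_left ((norm_le_pi_norm g i).trans hg) hN'.le).trans (Int.le_ceil _)
  refine ⟨z, ⟨fun i => ?_, fun i => ?_⟩, funext fun i => ?_⟩
  · exact_mod_cast (abs_le.1 (hzS i)).1
  · exact_mod_cast (abs_le.1 (hzS i)).2
  · dsimp only
    rw [← hz, mul_div_cancel_left₀ _ hN'.ne']

/-- If every ray meets `E` at most once and `E` consists of multiples of points of `G`, then the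
hull of `E` and the origin is of the form `rayHull b`. -/
theorem exists_eq_rayHull {V : Type*} [AddCommGroup V] [Module ℝ V] {A : Set ℝ}
    (hA : A ⊆ Set.Ioi 0) {E : Set V} (G : Finset V) (h0 : 0 ∈ convexHull ℝ E)
    (hray : ∀ v ∈ E, v ≠ 0 → ∀ s : ℝ, 0 < s → s • v ∈ E → s = 1)
    (hE : ∀ v ∈ E, v ≠ 0 → ∃ g ∈ G, ∃ a ∈ A, v = (1 / a) • g) :
    ∃ b : G → ℝ, (∀ g, b g ∈ (insert 0 ((fun a : ℝ => 1 / a) '' A) : Set ℝ)) ∧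
      convexHull ℝ E = rayHull b := by
  classical
  refine ⟨fun g => if h : ∃ a ∈ A, (1 / a) • (g : V) ∈ E then 1 / h.choose else 0, fun g => ?_, ?_⟩
  · dsimp only
    split_ifs with h
    · exact Or.inr ⟨_, h.choose_spec.1, rfl⟩
    · exact Or.inl rfl
  · refine (convexHull_min (fun v hv => ?_) (convex_convexHull ℝ _)).antisymm
      (convexHull_min ?_ (convex_convexHull ℝ _))
    · refine subset_convexHull ℝ _ ?_
      by_cases hv0 : v = 0
      · exact Or.inl hv0
      obtain ⟨g, hg, a, ha, rfl⟩ := hE v hv hv0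
      have h : ∃ a ∈ A, (1 / a) • g ∈ E := ⟨a, ha, hv⟩
      refine Or.inr ⟨⟨g, hg⟩, ?_⟩
      have ha0 : 0 < a := hA ha
      have hc0 : 0 < h.choose := hA h.choose_spec.1
      have hs := hray _ hv hv0 (a / h.choose) (by positivity) (by
        rw [smul_smul, div_mul_div_comm, mul_one, mul_comm h.choose, div_mul_cancel_left₀ ha0.ne',
          ← one_div]
        exact h.choose_spec.2)
      rw [div_eq_one_iff_eq hc0.ne'] at hs
      simp only [dif_pos h, ← hs]
    · rintro _ (rfl | ⟨g, rfl⟩)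
      · exact h0
      · dsimp only
        split_ifs with h
        · exact subset_convexHull ℝ _ h.choose_spec.2
        · simpa using h0

/-- The uniform bound in coordinates for which the coordinate vectors are multiples of
vertices; the lattice `L` then varies. -/
theorem exists_asymmetry_bound_of_axes (d : ℕ) (hd : 1 ≤ d) (A : Set ℝ) (hA : A ⊆ Set.Ioi 0)
    (hACC : ACCSet A) (ε : ℝ) (hε : 0 < ε) :
    ∃ c : ℝ, 0 < c ∧ ∀ (E : Set (Fin d → ℝ)) (L : AddSubgroup (Fin d → ℝ)),
      0 ∈ convexHull ℝ E →
      (∀ v ∈ E, v ≠ 0 → ∀ s : ℝ, 0 < s → s • v ∈ E → s = 1) →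
      (∀ v ∈ E, v ≠ 0 → ∃ g ∈ L, ∃ a ∈ A, v = (1 / a) • g) →
      (∀ i, Pi.single i 1 ∈ L ∧ ∃ a ∈ A, (1 / a) • Pi.single i (1 : ℝ) ∈ E) →
      AvoidsSmallDilations L ε (convexHull ℝ E) →
      ∀ p ∈ L, p ∈ interior (convexHull ℝ E) →
        ∀ x ∈ convexHull ℝ E, ∀ y ∈ convexHull ℝ E, p + c • (x - y) ∈ convexHull ℝ E := by
  obtain ⟨M, hM, hAM⟩ := hACC.exists_upper_bound hA
  obtain ⟨N, hN, hden⟩ := exists_common_denominator d hd M ε hM hε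
  obtain ⟨R, hR, hbound⟩ := exists_abs_le d hd M ε hM hε
  have := hACC.wellFoundedLT hA
  have hB : ∀ x ∈ (insert 0 ((fun a : ℝ => 1 / a) '' A) : Set ℝ), 0 ≤ x := by
    rintro _ (rfl | ⟨a, ha, rfl⟩)
    · exact le_rfl
    · exact one_div_nonneg.2 (hA ha).le
  set G := (finite_bounded_denominator d N hN (R + M * R)).toFinset with hG
  choose c hc hcK using fun p => exists_uniform_asymmetry G _ hB p R hR
  obtain ⟨p₀, -, hp₀⟩ := G.exists_min_image c ⟨0, by
    simp only [hG, Set.Finite.mem_toFinset]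
    exact ⟨⟨0, by simp⟩, by simp; positivity⟩⟩
  refine ⟨c p₀, hc p₀, fun E L h0 hray hE haxis hL p hpL hp x hx y hy => ?_⟩
  have hconv := convex_convexHull ℝ E
  have haxis' : ∀ i, Pi.single i (1 / M) ∈ convexHull ℝ E := fun i => by
    obtain ⟨-, a, ha, haE⟩ := haxis i
    have ha0 : 0 < a := hA ha
    have h := hconv.smul_mem_of_zero_mem h0 (subset_convexHull ℝ _ haE) (t := a / M)
      ⟨by positivity, (div_le_one hM).2 (hAM a ha)⟩
    rwa [smul_smul, ← Pi.single_smul, smul_eq_mul, mul_one, div_mul_div_comm, mul_one,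
      mul_comm M, div_mul_cancel_left₀ ha0.ne', ← one_div] at h
  have hZ : ∀ z : Fin d → ℤ, (fun i => (z i : ℝ)) ∈ L := fun z => by
    have hsum := L.sum_mem fun i (_ : i ∈ Finset.univ) => L.zsmul_mem (haxis i).1 (z i)
    convert hsum using 1
    ext j
    simp [Pi.single_apply]
  have hden' := hden _ L hconv h0 haxis' hZ hL
  have hbound' := hbound _ L hconv h0 haxis' hZ hL
  have hpG : p ∈ G := by
    simp only [hG, Set.Finite.mem_toFinset]
    refine ⟨hden' p hpL, (hbound' p (interior_subset hp)).trans ?_⟩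
    linarith [mul_pos hM hR]
  obtain ⟨b, hbB, hEb⟩ := exists_eq_rayHull hA G h0 hray fun v hv hv0 => by
    obtain ⟨g, hg, a, ha, rfl⟩ := hE v hv hv0
    refine ⟨g, ?_, a, ha, rfl⟩
    simp only [hG, Set.Finite.mem_toFinset]
    have ha0 : 0 < a := hA ha
    have h := hbound' _ (subset_convexHull ℝ _ hv)
    rw [norm_smul, Real.norm_of_nonneg (by positivity), one_div_mul_eq_div, div_le_iff₀ ha0] at h
    exact ⟨hden' g hg, by nlinarith [hAM a ha]⟩
  have hmem := hcK p b hbB (fun x hx => hbound' x (hEb ▸ hx)) (hEb ▸ hp) x (hEb ▸ hx) y (hEb ▸ hy)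
  rw [← hEb] at hmem
  have h := hconv.add_smul_mem (interior_subset hp) hmem (t := c p₀ / c p)
    ⟨(div_pos (hc _) (hc _)).le, (div_le_one (hc p)).2 (hp₀ p hpG)⟩
  rwa [smul_smul, div_mul_cancel₀ _ (hc p).ne'] at h

/-- The lattice `ℤ^d` as a subgroup of `ℝ^d`. -/
def intLatSubgroup (d : ℕ) : AddSubgroup (Fin d → ℝ) where
  carrier := intLat d
  zero_mem' := fun _ => ⟨0, by simp⟩
  add_mem' := fun hx hy i => by
    obtain ⟨a, ha⟩ := hx i
    obtain ⟨b, hb⟩ := hy i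
    exact ⟨a + b, by simp [ha, hb]⟩
  neg_mem' := fun hx i => by
    obtain ⟨a, ha⟩ := hx i
    exact ⟨-a, by simp [ha]⟩

theorem eq_one_of_smul_mem_extremePoints {V : Type*} [AddCommGroup V] [Module ℝ V] {K : Set V}
    (h0 : 0 ∈ K) {v : V} (hv : v ∈ K.extremePoints ℝ) (hv0 : v ≠ 0) {s : ℝ} (hs : 0 < s)
    (hsv : s • v ∈ K.extremePoints ℝ) : s = 1 := by
  have key : ∀ (w : V) (r : ℝ), w ≠ 0 → w ∈ K → r • w ∈ K.extremePoints ℝ → 0 < r → 1 ≤ r := by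
    intro w r hw0 hw hr hr0
    by_contra! hr1
    have h := hr.2 h0 hw ⟨1 - r, r, by linarith, hr0, by ring, by simp⟩
    exact (smul_ne_zero hr0.ne' hw0) h.symm
  refine le_antisymm ?_ (key v s hv0 hv.1 hsv hs)
  have h := key (s • v) s⁻¹ (smul_ne_zero hs.ne' hv0) hsv.1
    (by rwa [inv_smul_smul₀ hs.ne']) (inv_pos.2 hs)
  exact (one_le_inv₀ hs).1 h

/-- Fix `d ≥ 1`, an ACC set `A ⊆ (0, ∞)` and `ε > 0`. There is `c > 0`
such that for every compact polytope `□ = conv F ⊆ ℝ^d` with nonempty interior, `0 ∈ □`,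
every nonzero extremal point of the form `(1/a) • e` (`e ∈ ℤ^d` primitive, `a ∈ A`), a
lattice point interior to `□`, and such that no nonzero lattice vector lies in `t • (□ - □)`
for `0 < t < ε`, one has `γ(P ∈ □) ≥ c` for every lattice point `P` interior to `□`. -/
theorem stmt_8 (d : ℕ) (hd : 1 ≤ d) (A : Set ℝ) (hA : A ⊆ Set.Ioi 0) (hACC : ACCSet A)
    (ε : ℝ) (hε : 0 < ε) :
    ∃ c : ℝ, 0 < c ∧ ∀ (F : Finset (Fin d → ℝ)) (K : Set (Fin d → ℝ)),
      K = convexHull ℝ (F : Set (Fin d → ℝ)) →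
      (interior K).Nonempty →
      (0 : Fin d → ℝ) ∈ K →
      (∀ v ∈ Set.extremePoints ℝ K, v ≠ 0 →
        ∃ (e : Fin d → ℤ) (a : ℝ), Primitive e ∧ a ∈ A ∧ v = (1 / a) • fun i => (e i : ℝ)) →
      (intLat d ∩ interior K).Nonempty →
      (∀ v ∈ intLat d, v ≠ 0 → ∀ t : ℝ, 0 < t → t < ε → v ∉ t • (K - K)) →
      ∀ P ∈ intLat d ∩ interior K, c ≤ asym K P := by
  obtain ⟨c, hc, hcE⟩ := exists_asymmetry_bound_of_axes d hd A hA hACC ε hε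
  refine ⟨c, hc, fun F K hKF hint h0 hext _ hL P ⟨hPL, hP⟩ => ?_⟩
  have hcomp : IsCompact K := hKF ▸ F.finite_toSet.isCompact_convexHull ℝ
  have hconv : Convex ℝ K := hKF ▸ convex_convexHull ℝ _
  set E := K.extremePoints ℝ with hEdef
  have hEfin : E.Finite := F.finite_toSet.subset (hEdef ▸ hKF ▸ extremePoints_convexHull_subset)
  have hKE : convexHull ℝ E = K := by
    rw [← (hEfin.isClosed_convexHull ℝ).closure_eq]
    exact closure_convexHull_extremePoints hcomp hconv
  have hEL : ∀ v ∈ E, v ≠ 0 → ∃ g ∈ intLat d, ∃ a ∈ A, v = (1 / a) • g := fun v hv hv0 => by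
    obtain ⟨e, a, -, ha, rfl⟩ := hext v hv hv0
    exact ⟨_, fun i => ⟨e i, rfl⟩, a, ha, rfl⟩
  have hspan : ⊤ ≤ Submodule.span ℝ {w | w ∈ intLat d ∧ ∃ a ∈ A, (1 / a) • w ∈ E} := by
    refine (Submodule.eq_top_of_nonempty_interior' _ (hint.mono (interior_mono ?_))).ge
    rw [← hKE]
    refine convexHull_min (fun v hv => ?_) (Submodule.convex _)
    by_cases hv0 : v = 0
    · exact hv0 ▸ Submodule.zero_mem _
    · obtain ⟨g, hg, a, ha, rfl⟩ := hEL v hv hv0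
      exact Submodule.smul_mem _ _ (Submodule.subset_span ⟨hg, a, ha, hv⟩)
  let B₀ := Module.Basis.ofSpan hspan
  let B := B₀.reindex (B₀.indexEquiv (Pi.basisFun ℝ (Fin d)))
  have hB : ∀ i, B i ∈ intLat d ∧ ∃ a ∈ A, (1 / a) • B i ∈ E := fun i => by
    rw [Module.Basis.reindex_apply]
    exact Module.Basis.ofSpan_subset hspan ⟨_, rfl⟩
  let T := B.equivFun
  have hTB : ∀ i, T (B i) = Pi.single i 1 := fun i => by
    ext j
    rw [Module.Basis.equivFun_self, Pi.single_apply]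
    simp [eq_comm]
  have hTK : convexHull ℝ (T '' E) = T '' K := by
    rw [← hKE]
    exact (T.toLinearMap.image_convexHull E).symm
  have hTP : T P ∈ interior (T '' K) := by
    have := T.toContinuousLinearEquiv.toHomeomorph.image_interior K
    exact this ▸ ⟨P, hP, rfl⟩
  have hT := hcE (T '' E) ((intLatSubgroup d).map T.toLinearMap.toAddMonoidHom)
  rw [hTK] at hT
  refine le_asym hcomp.isBounded ?_ hc.le fun x hx y hy => ?_
  · have : Nonempty (Fin d) := ⟨⟨0, hd⟩⟩
    by_contra hnt
    have hsub := (Set.not_nontrivial_iff.1 hnt).anti interior_subset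
    obtain ⟨z, hz⟩ := hint
    have hopen : IsOpen ({z} : Set (Fin d → ℝ)) := by
      rw [← hsub.eq_singleton_of_mem hz]
      exact isOpen_interior
    exact not_isOpen_singleton z hopen
  have hmem := hT ⟨0, h0, map_zero T⟩ ?_ ?_ ?_ ?_ (T P) ⟨P, hPL, rfl⟩ hTP
    (T x) ⟨x, hx, rfl⟩ (T y) ⟨y, hy, rfl⟩
  · rwa [← map_sub, ← map_smul, ← map_add, T.injective.mem_set_image] at hmem
  · rintro _ ⟨v, hv, rfl⟩ hv0 s hs hsv
    rw [← map_smul, T.injective.mem_set_image] at hsv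
    exact eq_one_of_smul_mem_extremePoints h0 hv (fun h => hv0 (by rw [h, map_zero])) hs hsv
  · rintro _ ⟨v, hv, rfl⟩ hv0
    obtain ⟨g, hg, a, ha, rfl⟩ := hEL v hv (fun h => hv0 (by rw [h, map_zero]))
    exact ⟨T g, ⟨g, hg, rfl⟩, a, ha, map_smul T _ _⟩
  · intro i
    obtain ⟨hBi, a, ha, haE⟩ := hB i
    refine ⟨⟨B i, hBi, hTB i⟩, a, ha, (1 / a) • B i, haE, ?_⟩
    rw [map_smul, hTB]
  · rintro _ ⟨v, hv, rfl⟩ hv0 t ht htε ⟨_, ⟨_, ⟨x, hx, rfl⟩, _, ⟨y, hy, rfl⟩, rfl⟩, hxy⟩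
    refine hL v hv (fun h => hv0 (by rw [h, map_zero])) t ht htε
      ⟨x - y, Set.sub_mem_sub hx hy, T.injective ?_⟩
    simpa using hxy
end

section
/- Fix d ≥ 1 and a set A ⊆ (0, ∞) satisfying ACC. Then there exists ε > 0 with the following property: for every compact polytope □ = conv(F) ⊆ ℝ^d, where F is a finite set, such that □ has nonempty interior, ℤ^d ∩ interior □ = ∅, 0 ∈ □, and every nonzero extremal point of □ is of the form (1/a) • e with e ∈ ℤ^d primitive and a ∈ A, there exist an integer p with 1 ≤ p ≤ d and a surjective linear map π : ℝ^d → ℝ^p with π(ℤ^d) = ℤ^p, such that the image polytope □' = π(□) satisfies ℤ^p ∩ interior □' = ∅ and, for every nonzero v ∈ ℤ^p and every t with 0 < t < ε, v ∉ t • (□' − □'). -/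
open Pointwise

/-- The character `x ↦ exp (2πix)` of the real line. -/
noncomputable def unitExp (x : ℝ) : ℂ := Complex.exp ((2 * Real.pi * x : ℝ) * Complex.I)

lemma unitExp_add (x y : ℝ) : unitExp (x + y) = unitExp x * unitExp y := by
  simp only [unitExp, ← Complex.exp_add]
  congr 1
  push_cast
  ring

lemma unitExp_zero : unitExp 0 = 1 := by simp [unitExp]

lemma norm_unitExp (x : ℝ) : ‖unitExp x‖ = 1 := Complex.norm_exp_ofReal_mul_I _

lemma conj_unitExp (x : ℝ) : (starRingEnd ℂ) (unitExp x) = unitExp (-x) := by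
  simp only [unitExp, ← Complex.exp_conj]
  congr 1
  rw [map_mul, Complex.conj_I, Complex.conj_ofReal]
  push_cast
  ring

lemma unitExp_sum {α : Type*} (s : Finset α) (f : α → ℝ) :
    unitExp (∑ i ∈ s, f i) = ∏ i ∈ s, unitExp (f i) := by
  classical
  induction s using Finset.induction_on with
  | empty => simp [unitExp_zero]
  | insert a s ha ih => rw [Finset.sum_insert ha, Finset.prod_insert ha, unitExp_add, ih]

lemma unitExp_nat_mul (n : ℕ) (x : ℝ) : unitExp (n * x) = unitExp x ^ n := by
  rw [unitExp, unitExp, ← Complex.exp_nat_mul]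
  congr 1
  push_cast
  ring

lemma unitExp_eq_one_iff (x : ℝ) : unitExp x = 1 ↔ ∃ m : ℤ, x = m := by
  rw [unitExp, Complex.exp_eq_one_iff]
  refine exists_congr fun m => ?_
  have h : (2 * (Real.pi : ℂ) * Complex.I) ≠ 0 := Complex.two_pi_I_ne_zero
  constructor
  · intro hm
    have : ((x : ℝ) : ℂ) = m := by
      apply mul_right_cancel₀ h
      rw [← hm]
      push_cast
      ring
    exact_mod_cast this
  · rintro rfl
    push_cast
    ring

/-- The distance from `x` to the nearest integer is controlled by `‖unitExp x - 1‖`. -/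
lemma abs_sub_round_le_norm_unitExp (x : ℝ) : |x - round x| ≤ ‖unitExp x - 1‖ := by
  set u := x - round x with hu
  have hx : unitExp x = unitExp u := by
    have : x = u + round x := by simp [hu]
    rw [this, unitExp_add, (unitExp_eq_one_iff _).2 ⟨_, rfl⟩, mul_one]
  have hu2 : |u| ≤ 1 / 2 := abs_sub_round x
  have h1 : ‖unitExp u - 1‖ = 2 * |Real.sin (Real.pi * u)| := by
    have := Complex.norm_exp_I_mul_ofReal_sub_one (2 * Real.pi * u)
    rw [unitExp, mul_comm, this, norm_mul, Real.norm_eq_abs, Real.norm_eq_abs]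
    norm_num
    congr 2
    ring
  have h2 : |Real.sin (Real.pi * u)| = Real.sin (Real.pi * |u|) := by
    rcases abs_cases u with ⟨h, h'⟩ | ⟨h, h'⟩
    · rw [h, abs_of_nonneg]
      apply Real.sin_nonneg_of_nonneg_of_le_pi
      · positivity
      · nlinarith [Real.pi_pos]
    · rw [h, mul_neg, Real.sin_neg, abs_of_nonpos]
      apply Real.sin_nonpos_of_nonpos_of_neg_pi_le
      · nlinarith [Real.pi_pos]
      · nlinarith [Real.pi_pos]
  have h3 : 2 / Real.pi * (Real.pi * |u|) ≤ Real.sin (Real.pi * |u|) :=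
    Real.mul_le_sin (by positivity) (by nlinarith [Real.pi_pos])
  have h4 : 2 / Real.pi * (Real.pi * |u|) = 2 * |u| := by
    field_simp
  rw [hx, h1, h2]
  nlinarith [abs_nonneg u]

/-- The linear form with integral coefficients `r`. -/
def intForm {ι : Type*} [Fintype ι] (r : ι → ℤ) (x : ι → ℝ) : ℝ := ∑ i, (r i : ℝ) * x i

section Kronecker

variable {ι : Type*}

/-- The zero vector and the standard basis vectors of `ℤ^ι`. -/
def letterVec [DecidableEq ι] (o : Option ι) : ι → ℤ := o.elim 0 fun i => Pi.single i 1

/-- The sum of the vectors attached to the letters of a word. -/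
def wordVec [DecidableEq ι] {M : ℕ} (s : Fin M → Option ι) : ι → ℤ := ∑ k, letterVec (s k)

lemma wordVec_mem [DecidableEq ι] {M : ℕ} (s : Fin M → Option ι) (i : ι) :
    wordVec s i ∈ Finset.Icc (0 : ℤ) M := by
  have h : ∀ k, 0 ≤ letterVec (s k) i ∧ letterVec (s k) i ≤ 1 := by
    intro k
    rcases s k with _ | j
    · simp [letterVec]
    · by_cases hij : i = j
      · subst hij
        simp [letterVec]
      · simp [letterVec, hij]
  rw [Finset.mem_Icc, wordVec, Finset.sum_apply]
  refine ⟨Finset.sum_nonneg fun k _ => (h k).1, ?_⟩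
  calc ∑ k, letterVec (s k) i ≤ ∑ _k : Fin M, (1 : ℤ) := Finset.sum_le_sum fun k _ => (h k).2
    _ = M := by simp

variable [Fintype ι]

lemma intForm_zero (x : ι → ℝ) : intForm 0 x = 0 := by simp [intForm]

lemma intForm_add (r s : ι → ℤ) (x : ι → ℝ) : intForm (r + s) x = intForm r x + intForm s x := by
  simp [intForm, add_mul, Finset.sum_add_distrib]

lemma intForm_sub (r s : ι → ℤ) (x : ι → ℝ) : intForm (r - s) x = intForm r x - intForm s x := by
  simp [intForm, sub_mul, Finset.sum_sub_distrib]

lemma intForm_sum {α : Type*} (s : Finset α) (f : α → ι → ℤ) (x : ι → ℝ) :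
    intForm (∑ k ∈ s, f k) x = ∑ k ∈ s, intForm (f k) x := by
  simp only [intForm, Finset.sum_apply, Int.cast_sum, Finset.sum_mul]
  exact Finset.sum_comm

variable [DecidableEq ι]

/-- The trigonometric polynomial `1 + ∑ exp (2πi xᵢ)`. -/
noncomputable def trigSum (x : ι → ℝ) : ℂ := ∑ o : Option ι, unitExp (intForm (letterVec o) x)

lemma trigSum_pow (M : ℕ) (x : ι → ℝ) :
    trigSum x ^ M = ∑ s : Fin M → Option ι, unitExp (intForm (wordVec s) x) := by
  rw [trigSum, Fintype.sum_pow]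
  refine Finset.sum_congr rfl fun s _ => ?_
  rw [wordVec, intForm_sum, unitExp_sum]

lemma norm_trigSum_pow (M : ℕ) (x : ι → ℝ) :
    ((‖trigSum x‖ ^ (2 * M) : ℝ) : ℂ) =
      ∑ p : (Fin M → Option ι) × (Fin M → Option ι),
        unitExp (intForm (wordVec p.1 - wordVec p.2) x) := by
  have h1 : ((‖trigSum x‖ ^ (2 * M) : ℝ) : ℂ) =
      trigSum x ^ M * (starRingEnd ℂ) (trigSum x ^ M) := by
    rw [Complex.mul_conj, Complex.normSq_eq_norm_sq, norm_pow, ← pow_mul, mul_comm M 2]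
  rw [h1, trigSum_pow, map_sum, Finset.sum_mul_sum, Fintype.sum_prod_type]
  refine Finset.sum_congr rfl fun s _ => Finset.sum_congr rfl fun t _ => ?_
  rw [conj_unitExp, ← unitExp_add, intForm_sub, sub_eq_add_neg]

lemma trigSum_eq (x : ι → ℝ) : trigSum x = 1 + ∑ i, unitExp (x i) := by
  simp [trigSum, Fintype.sum_option, letterVec, unitExp_zero, intForm,
    Pi.single_apply]

/-- If `trigSum x` is almost maximal then every coordinate of `x` is almost an integer. -/
lemma exists_gap_of_norm_trigSum {η : ℝ} (hη : 0 < η) :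
    ∃ q : ℝ, 0 ≤ q ∧ q < Fintype.card ι + 1 ∧
      ∀ x : ι → ℝ, q < ‖trigSum x‖ → ∀ i, |x i - round (x i)| < η := by
  obtain ⟨κ, hκ0, hκ1, hκ⟩ : ∃ κ : ℝ, 0 < κ ∧ κ ≤ 1 ∧ 4 * κ < η ^ 2 := by
    refine ⟨min 1 (η ^ 2 / 8), by positivity, min_le_left _ _, ?_⟩
    have := min_le_right 1 (η ^ 2 / 8)
    nlinarith [sq_nonneg η, pow_pos hη 2]
  refine ⟨Fintype.card ι + 1 - κ, ?_, by linarith, ?_⟩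
  · have : (0 : ℝ) ≤ Fintype.card ι := by positivity
    linarith
  intro x hx i
  by_contra! hi
  have h1 : η ≤ ‖unitExp (x i) - 1‖ := hi.trans (abs_sub_round_le_norm_unitExp _)
  have h2 : ‖1 + unitExp (x i)‖ ^ 2 + ‖unitExp (x i) - 1‖ ^ 2 = 4 := by
    have := parallelogram_law_with_norm ℝ (unitExp (x i)) 1
    rw [norm_unitExp, norm_one] at this
    rw [add_comm 1]
    nlinarith
  have h3 : ‖1 + unitExp (x i)‖ < 2 - κ := by
    nlinarith [norm_nonneg (1 + unitExp (x i))]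
  have h4 : ‖trigSum x‖ ≤ ‖1 + unitExp (x i)‖ + ∑ j ∈ Finset.univ.erase i, ‖unitExp (x j)‖ := by
    rw [trigSum_eq, ← Finset.add_sum_erase _ _ (Finset.mem_univ i), ← add_assoc]
    refine (norm_add_le _ _).trans ?_
    gcongr
    exact norm_sum_le _ _
  have h5 : ∑ j ∈ Finset.univ.erase i, ‖unitExp (x j)‖ = Fintype.card ι - 1 := by
    simp only [norm_unitExp, Finset.sum_const, nsmul_eq_mul, mul_one]
    rw [Finset.card_erase_of_mem (Finset.mem_univ i), Finset.card_univ,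
      Nat.cast_sub (Fintype.card_pos_iff.2 ⟨i⟩)]
    simp
  linarith

/-- Many pairs of words have the same vector. -/
lemma card_pow_le_card_pairs (M : ℕ) :
    ((Fintype.card ι + 1 : ℝ)) ^ (2 * M) ≤ (M + 1) ^ Fintype.card ι *
      ((Finset.univ.filter fun p : (Fin M → Option ι) × (Fin M → Option ι) =>
        wordVec p.1 = wordVec p.2).card : ℝ) := by
  classical
  set T : Finset (ι → ℤ) := Fintype.piFinset fun _ => Finset.Icc (0 : ℤ) M with hT
  have hmaps : ∀ s ∈ (Finset.univ : Finset (Fin M → Option ι)), wordVec s ∈ T := by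
    intro s _
    rw [hT, Fintype.mem_piFinset]
    exact wordVec_mem s
  have hcardT : (T.card : ℝ) = (M + 1) ^ Fintype.card ι := by
    rw [hT, Fintype.card_piFinset]
    simp
  have h1 := Finset.card_eq_sum_card_fiberwise hmaps
  have h2 : (Finset.univ.filter fun p : (Fin M → Option ι) × (Fin M → Option ι) =>
        wordVec p.1 = wordVec p.2).card =
      ∑ b ∈ T, (Finset.univ.filter fun s : Fin M → Option ι => wordVec s = b).card ^ 2 := by
    rw [Finset.card_eq_sum_card_fiberwise (f := fun p => wordVec p.1) (t := T)
      (fun p _ => hmaps _ (Finset.mem_univ _))]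
    refine Finset.sum_congr rfl fun b _ => ?_
    rw [sq, ← Finset.card_product]
    congr 1
    ext p
    simp only [Finset.mem_filter, Finset.mem_univ, true_and, Finset.mem_product]
    constructor
    · rintro ⟨h, h'⟩
      exact ⟨h', h ▸ h'⟩
    · rintro ⟨h, h'⟩
      exact ⟨h.trans h'.symm, h⟩
  have h3 := sq_sum_le_card_mul_sum_sq (s := T)
    (f := fun b => ((Finset.univ.filter fun s : Fin M → Option ι => wordVec s = b).card : ℝ))
  have h4 : (∑ b ∈ T, ((Finset.univ.filter fun s : Fin M → Option ι => wordVec s = b).card : ℝ))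
      = (Fintype.card ι + 1 : ℝ) ^ M := by
    rw [← Nat.cast_sum, ← h1]
    simp
  rw [h4, hcardT, ← pow_mul, mul_comm M 2] at h3
  rw [h2]
  push_cast
  exact h3

/-- A geometric sum of a nontrivial character is bounded. -/
lemma exists_bound_sum_unitExp (θ c : ℝ) (hθ : ¬ ∃ m : ℤ, θ = m) :
    ∃ B : ℝ, ∀ J : ℕ, ‖∑ j ∈ Finset.range J, unitExp (j * θ - c)‖ ≤ B := by
  have hne : unitExp θ ≠ 1 := fun h => hθ ((unitExp_eq_one_iff θ).1 h)
  refine ⟨2 / ‖unitExp θ - 1‖, fun J => ?_⟩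
  have h1 : ∑ j ∈ Finset.range J, unitExp (j * θ - c) =
      (unitExp θ ^ J - 1) / (unitExp θ - 1) * unitExp (-c) := by
    rw [← geom_sum_eq hne, Finset.sum_mul]
    refine Finset.sum_congr rfl fun j _ => ?_
    rw [sub_eq_add_neg, unitExp_add, unitExp_nat_mul]
  rw [h1, norm_mul, norm_unitExp, mul_one, norm_div]
  gcongr
  calc ‖unitExp θ ^ J - 1‖ ≤ ‖unitExp θ ^ J‖ + ‖(1 : ℂ)‖ := norm_sub_le _ _
    _ = 2 := by rw [norm_pow, norm_unitExp]; norm_num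

/-- A uniform version of Kronecker's approximation theorem: to approximate `z` modulo `ℤ^ι` by
multiples of `y` up to `η`, only finitely many integral relations have to be checked. -/
theorem exists_finset_kronecker {η : ℝ} (hη : 0 < η) :
    ∃ S : Finset (ι → ℤ), ∀ y z : ι → ℝ,
      (∀ r ∈ S, (∃ m : ℤ, intForm r y = m) → ∃ m : ℤ, intForm r z = m) →
      ∃ (j : ℕ) (k : ι → ℤ), ∀ i, |j * y i - k i - z i| < η := by
  classical
  obtain ⟨q, hq0, hq1, hq⟩ := exists_gap_of_norm_trigSum (ι := ι) hη
  set D : ℝ := Fintype.card ι + 1 with hD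
  have hDpos : 0 < D := by positivity
  obtain ⟨M, hM⟩ : ∃ M : ℕ, (M + 1 : ℝ) ^ Fintype.card ι * q ^ (2 * M) < D ^ (2 * M) := by
    set ρ := (q / D) ^ 2 with hρ
    have hρ0 : 0 ≤ ρ := by positivity
    have hρ1 : ρ < 1 := by
      have : q / D < 1 := (div_lt_one hDpos).2 hq1
      have h0 : 0 ≤ q / D := by positivity
      nlinarith
    have hlim := tendsto_pow_const_mul_const_pow_of_abs_lt_one (Fintype.card ι)
      (r := ρ) (by rwa [abs_of_nonneg hρ0])
    by_cases hρz : ρ = 0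
    · refine ⟨1, ?_⟩
      have : q = 0 := by
        have h := pow_eq_zero_iff (two_ne_zero) |>.1 hρz
        rcases div_eq_zero_iff.1 h with h | h
        · exact h
        · exact absurd h hDpos.ne'
      rw [this]
      simp
      positivity
    have hρpos : 0 < ρ := lt_of_le_of_ne hρ0 (Ne.symm hρz)
    obtain ⟨n, hn, hn1⟩ := ((hlim.eventually (gt_mem_nhds hρpos)).and
      (Filter.eventually_ge_atTop 1)).exists
    obtain ⟨M, rfl⟩ : ∃ M, n = M + 1 := ⟨n - 1, by omega⟩
    refine ⟨M, ?_⟩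
    have h1 : ((M : ℝ) + 1) ^ Fintype.card ι * ρ ^ M < 1 := by
      rw [pow_succ, ← mul_assoc] at hn
      push_cast at hn
      by_contra! h
      nlinarith
    have h2 : ρ ^ M * D ^ (2 * M) = q ^ (2 * M) := by
      rw [hρ, ← pow_mul, div_pow, div_mul_cancel₀ _ (by positivity)]
    rw [← h2, ← mul_assoc]
    have : 0 < D ^ (2 * M) := by positivity
    nlinarith
  refine ⟨Finset.univ.image fun p : (Fin M → Option ι) × (Fin M → Option ι) =>
    wordVec p.1 - wordVec p.2, fun y z hyz => ?_⟩
  by_contra! hcon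
  have hsmall : ∀ j : ℕ, ‖trigSum fun i => j * y i - z i‖ ≤ q := by
    intro j
    by_contra! h
    obtain ⟨i, hi⟩ := hcon j (fun i => round (j * y i - z i))
    have := hq _ h i
    rw [sub_right_comm] at hi
    linarith
  have hform : ∀ (r : ι → ℤ) (j : ℕ),
      intForm r (fun i => j * y i - z i) = j * intForm r y - intForm r z := by
    intro r j
    simp only [intForm, Finset.mul_sum, ← Finset.sum_sub_distrib]
    exact Finset.sum_congr rfl fun i _ => by ring
  set good : Finset ((Fin M → Option ι) × (Fin M → Option ι)) :=
    Finset.univ.filter fun p => ∃ m : ℤ, intForm (wordVec p.1 - wordVec p.2) y = m with hgood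
  have hB : ∀ p : (Fin M → Option ι) × (Fin M → Option ι), ∃ B : ℝ, p ∉ good → ∀ J : ℕ,
      ‖∑ j ∈ Finset.range J, unitExp (intForm (wordVec p.1 - wordVec p.2)
        fun i => j * y i - z i)‖ ≤ B := by
    intro p
    by_cases hp : p ∈ good
    · exact ⟨0, fun h => absurd hp h⟩
    · have hp' : ¬ ∃ m : ℤ, intForm (wordVec p.1 - wordVec p.2) y = m := by
        simpa [hgood] using hp
      obtain ⟨B, hB⟩ := exists_bound_sum_unitExp _ (intForm (wordVec p.1 - wordVec p.2) z) hp'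
      refine ⟨B, fun _ J => ?_⟩
      simp only [hform]
      exact hB J
  choose B hB using hB
  have hgood1 : ∀ p ∈ good, ∀ j : ℕ, unitExp (intForm (wordVec p.1 - wordVec p.2)
      fun i => j * y i - z i) = 1 := by
    intro p hp j
    have hp' : ∃ m : ℤ, intForm (wordVec p.1 - wordVec p.2) y = m := by simpa [hgood] using hp
    obtain ⟨m', hm'⟩ := hyz _ (Finset.mem_image_of_mem _ (Finset.mem_univ p)) hp'
    obtain ⟨m, hm⟩ := hp'
    rw [hform, hm, hm', unitExp_eq_one_iff]
    exact ⟨j * m - m', by push_cast; ring⟩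
  have hJ : ∀ J : ℕ, (J : ℝ) * good.card ≤ J * q ^ (2 * M) + ∑ p ∈ goodᶜ, B p := by
    intro J
    have e1 : ((∑ j ∈ Finset.range J, ‖trigSum fun i => j * y i - z i‖ ^ (2 * M) : ℝ) : ℂ) =
        (J : ℂ) * good.card + ∑ p ∈ goodᶜ, ∑ j ∈ Finset.range J,
          unitExp (intForm (wordVec p.1 - wordVec p.2) fun i => j * y i - z i) := by
      rw [Complex.ofReal_sum]
      simp only [norm_trigSum_pow]
      rw [Finset.sum_comm, ← Finset.sum_add_sum_compl good]
      congr 1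
      rw [Finset.sum_congr rfl fun p hp => Finset.sum_congr rfl fun j _ => hgood1 p hp j]
      simp [mul_comm]
    have e2 : (J : ℝ) * good.card = ‖((J : ℂ) * good.card)‖ := by
      rw [norm_mul, Complex.norm_natCast, Complex.norm_natCast]
    rw [e2, eq_sub_of_add_eq e1.symm]
    refine (norm_sub_le _ _).trans (add_le_add ?_ ?_)
    · rw [Complex.norm_real, Real.norm_of_nonneg (by positivity)]
      calc _ ≤ ∑ j ∈ Finset.range J, q ^ (2 * M) := by
            refine Finset.sum_le_sum fun j _ => ?_
            have := hsmall j
            gcongr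
        _ = J * q ^ (2 * M) := by simp
    · refine (norm_sum_le _ _).trans (Finset.sum_le_sum fun p hp => ?_)
      exact hB p (Finset.mem_compl.1 hp) J
  have hcard : (good.card : ℝ) ≤ q ^ (2 * M) := by
    by_contra! h
    obtain ⟨J, hJ'⟩ := exists_nat_gt ((∑ p ∈ goodᶜ, B p) / (good.card - q ^ (2 * M)))
    rw [div_lt_iff₀ (by linarith)] at hJ'
    have := hJ J
    linarith
  have hle : ((Finset.univ.filter fun p : (Fin M → Option ι) × (Fin M → Option ι) =>
        wordVec p.1 = wordVec p.2).card : ℝ) ≤ good.card := by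
    norm_cast
    refine Finset.card_le_card fun p hp => ?_
    simp only [Finset.mem_filter, Finset.mem_univ, true_and, hgood] at hp ⊢
    exact ⟨0, by rw [hp, sub_self, intForm_zero]; simp⟩
  have hpairs := card_pow_le_card_pairs (ι := ι) M
  have : D ^ (2 * M) ≤ (M + 1 : ℝ) ^ Fintype.card ι * q ^ (2 * M) :=
    hpairs.trans (by gcongr; exact hle.trans hcard)
  linarith

end Kronecker

lemma ACCSet.exists_max {A B : Set ℝ} (hA : ACCSet A) (hBA : B ⊆ A) (hB : B.Nonempty) :
    ∃ m ∈ B, ∀ b ∈ B, b ≤ m := by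
  by_contra! h
  choose! g hgB hg using h
  obtain ⟨b, hb⟩ := hB
  have hmem : ∀ n, g^[n] b ∈ B := by
    intro n
    induction n with
    | zero => exact hb
    | succ n ih =>
      rw [Function.iterate_succ_apply']
      exact hgB _ ih
  refine hA ⟨fun n => g^[n] b, strictMono_nat_of_lt_succ fun n => ?_, fun n => hBA (hmem n)⟩
  rw [Function.iterate_succ_apply']
  exact hg _ (hmem n)

/-- A limit of elements of an ACC set is eventually a lower bound. -/
lemma ACCSet.eventually_le {A : Set ℝ} (hA : ACCSet A) {l : Filter ℕ} {a : ℕ → ℝ} {α : ℝ}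
    (ha : ∀ n, a n ∈ A) (hlim : Filter.Tendsto a l (nhds α)) : ∀ᶠ n in l, α ≤ a n := by
  by_cases hne : (A ∩ Set.Iio α).Nonempty
  · obtain ⟨m, hm, hmax⟩ := hA.exists_max Set.inter_subset_left hne
    filter_upwards [hlim.eventually (lt_mem_nhds hm.2)] with n hn
    by_contra! h
    exact absurd (hmax (a n) ⟨ha n, h⟩) (not_le.2 hn)
  · refine Filter.Eventually.of_forall fun n => ?_
    by_contra! h
    exact hne ⟨a n, ha n, h⟩

/-- Given points `y n` of `ℝ^ι`, some `y m` satisfies all the integral relations that hold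
for almost all `y n` and, by Kronecker's theorem, is approximated by the multiples of
almost all `y n`. -/
lemma exists_frequently_approx {ι : Type*} [Fintype ι] (U : Ultrafilter ℕ) (y : ℕ → ι → ℝ)
    {P : ℕ → Prop} (hP : ∀ᶠ n in (U : Filter ℕ), P n) :
    ∃ m, P m ∧ ∀ η : ℝ, 0 < η → ∀ᶠ n in (U : Filter ℕ),
      ∃ (j : ℕ) (k : ι → ℤ), ∀ i, |j * y n i - k i - y m i| < η := by
  classical
  let R : ℕ → Submodule ℤ (ι → ℤ) := fun n =>
    { carrier := {r | ∃ m : ℤ, intForm r (y n) = m}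
      add_mem' := by
        rintro r s ⟨m, hm⟩ ⟨m', hm'⟩
        exact ⟨m + m', by rw [intForm_add, hm, hm']; push_cast; rfl⟩
      zero_mem' := ⟨0, by rw [intForm_zero]; simp⟩
      smul_mem' := by
        rintro c r ⟨m, hm⟩
        refine ⟨c * m, ?_⟩
        push_cast
        rw [← hm]
        simp [intForm, Finset.mul_sum, mul_assoc] }
  let L : Submodule ℤ (ι → ℤ) :=
    { carrier := {r | ∀ᶠ n in (U : Filter ℕ), r ∈ R n}
      add_mem' := fun hr hs => by
        filter_upwards [hr, hs] with n h h' using add_mem h h'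
      zero_mem' := Filter.Eventually.of_forall fun n => zero_mem _
      smul_mem' := fun c r hr => by
        filter_upwards [hr] with n h using Submodule.smul_mem _ c h }
  obtain ⟨T, hT⟩ := IsNoetherian.noetherian L
  have hTU : ∀ᶠ n in (U : Filter ℕ), ∀ r ∈ T, r ∈ R n := by
    rw [Filter.eventually_all_finset]
    intro r hr
    have : r ∈ L := hT ▸ Submodule.subset_span hr
    exact this
  obtain ⟨m, hm, hPm⟩ := (hTU.and hP).exists
  have hLm : L ≤ R m := by
    rw [← hT, Submodule.span_le]
    exact hm
  refine ⟨m, hPm, fun η hη => ?_⟩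
  obtain ⟨S, hS⟩ := exists_finset_kronecker (ι := ι) hη
  have hSU : ∀ᶠ n in (U : Filter ℕ), ∀ r ∈ S, r ∈ R n → r ∈ L := by
    rw [Filter.eventually_all_finset]
    intro r _
    by_cases hr : r ∈ L
    · exact Filter.Eventually.of_forall fun _ _ => hr
    · have : ∀ᶠ n in (U : Filter ℕ), ¬ r ∈ R n := Ultrafilter.eventually_not.2 hr
      filter_upwards [this] with n hn h using absurd h hn
  filter_upwards [hSU] with n hn
  exact hS (y n) (y m) fun r hr hrn => hLm (hn r hr hrn)

/-- Multiples of a point `β` of the open unit simplex, reduced modulo the `a i` with `a i` in an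
ACC set, reach a depth in the simplex that depends only on the ACC set. -/
theorem exists_uniform_depth (ι : Type*) [Fintype ι] {A : Set ℝ} (hA : A ⊆ Set.Ioi 0)
    (hACC : ACCSet A) :
    ∃ δ : ℝ, 0 < δ ∧ ∀ a β : ι → ℝ, (∀ i, a i ∈ A) → (∀ i, 0 < β i) → ∑ i, β i < 1 →
      ∃ (j : ℕ) (k : ι → ℤ), (∀ i, δ ≤ j * β i - k i * a i) ∧
        ∑ i, (j * β i - k i * a i) ≤ 1 - δ := by
  by_contra! hcon
  choose a β haA hβ hβ1 hbad using fun n : ℕ =>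
    hcon (1 / ((n : ℝ) + 1)) Nat.one_div_pos_of_nat
  have ha0 : ∀ n i, 0 < a n i := fun n i => hA (haA n i)
  set U : Ultrafilter ℕ := Filter.hyperfilter ℕ with hU
  have hUtop : (U : Filter ℕ) ≤ Filter.atTop := by
    rw [hU, ← Nat.cofinite_eq_atTop]
    exact Filter.hyperfilter_le_cofinite
  have hlim : ∀ i, ∃ α, 0 ≤ α ∧
      Filter.Tendsto (fun n => a n i) (U : Filter ℕ) (nhds α) := by
    intro i
    obtain ⟨C, -, hC⟩ := hACC.exists_max subset_rfl ⟨_, haA 0 i⟩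
    obtain ⟨α, hα, h⟩ := (isCompact_Icc (a := (0 : ℝ)) (b := C)).ultrafilter_le_nhds
      (U.map fun n => a n i) (by
        rw [Ultrafilter.coe_map, Filter.le_principal_iff, Filter.mem_map]
        exact Filter.Eventually.of_forall fun n => ⟨(ha0 n i).le, hC _ (haA n i)⟩)
    exact ⟨α, hα.1, h⟩
  choose α hα0 hα using hlim
  have hle : ∀ᶠ n in (U : Filter ℕ), ∀ i, α i ≤ a n i :=
    Filter.eventually_all.2 fun i => hACC.eventually_le (fun n => haA n i) (hα i)
  obtain ⟨m, hm, happrox⟩ := exists_frequently_approx U (fun n i => β n i / a n i) hle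
  set z : ι → ℝ := fun i => β m i / a m i with hz
  have hz0 : ∀ i, 0 < z i := fun i => div_pos (hβ m i) (ha0 m i)
  have hz1 : ∑ i, α i * z i < 1 := by
    refine lt_of_le_of_lt (Finset.sum_le_sum fun i _ => ?_) (hβ1 m)
    calc α i * z i ≤ a m i * z i := mul_le_mul_of_nonneg_right (hm i) (hz0 i).le
      _ = β m i := mul_div_cancel₀ _ (ha0 m i).ne'
  set N : ℝ := (Fintype.card ι : ℝ) with hN
  have hN0 : 0 ≤ N := by positivity
  set σ : ℝ := (1 - ∑ i, α i * z i) / (N + 1) with hσ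
  have hσ0 : 0 < σ := div_pos (by linarith) (by linarith)
  have hσN : ∑ i, α i * z i + N * σ = 1 - σ := by
    rw [hσ]
    field_simp
    ring
  set τ : ι → ℝ := fun i => if α i = 0 then σ else α i * z i with hτ
  have hτ0 : ∀ i, 0 < τ i := by
    intro i
    by_cases h : α i = 0
    · simpa [hτ, h] using hσ0
    · simp only [hτ, h, if_false]
      exact mul_pos (lt_of_le_of_ne (hα0 i) (Ne.symm h)) (hz0 i)
  have hτ1 : ∑ i, τ i ≤ 1 - σ := by
    rw [← hσN]
    calc ∑ i, τ i ≤ ∑ i, (α i * z i + σ) := by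
          refine Finset.sum_le_sum fun i _ => ?_
          by_cases h : α i = 0
          · simp [hτ, h]
          · simp only [hτ, h, if_false]
            linarith
      _ = _ := by simp [Finset.sum_add_distrib, hN]
  obtain ⟨κ, hκ0, hκτ, hκσ⟩ : ∃ κ : ℝ, 0 < κ ∧ (∀ i, 2 * κ ≤ τ i) ∧ (N + 1) * κ ≤ σ := by
    have h1 : ∀ᶠ κ in nhdsWithin (0 : ℝ) (Set.Ioi 0), ∀ i, 2 * κ ≤ τ i := by
      rw [Filter.eventually_all]
      intro i
      have : Filter.Tendsto (fun κ : ℝ => 2 * κ) (nhds 0) (nhds (2 * 0)) :=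
        Filter.tendsto_id.const_mul 2
      exact ((this.eventually (ge_mem_nhds (by simpa using hτ0 i))).filter_mono
        nhdsWithin_le_nhds)
    have h2 : ∀ᶠ κ in nhdsWithin (0 : ℝ) (Set.Ioi 0), (N + 1) * κ ≤ σ := by
      have : Filter.Tendsto (fun κ : ℝ => (N + 1) * κ) (nhds 0) (nhds ((N + 1) * 0)) :=
        Filter.tendsto_id.const_mul _
      exact ((this.eventually (ge_mem_nhds (by simpa using hσ0))).filter_mono
        nhdsWithin_le_nhds)
    obtain ⟨κ, ⟨hκ1, hκ2⟩, hκ0⟩ := ((h1.and h2).and self_mem_nhdsWithin).exists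
    exact ⟨κ, hκ0, hκ1, hκ2⟩
  obtain ⟨η, hη0, hη⟩ : ∃ η : ℝ, 0 < η ∧ ∀ i, α i * η < κ := by
    refine ⟨κ / (∑ i, α i + 1), ?_, fun i => ?_⟩
    · have : 0 ≤ ∑ i, α i := Finset.sum_nonneg fun i _ => hα0 i
      positivity
    · have h1 : α i ≤ ∑ i, α i := Finset.single_le_sum (fun i _ => hα0 i) (Finset.mem_univ i)
      rw [mul_div_assoc', div_lt_iff₀ (by linarith [hα0 i])]
      nlinarith
  have hclose : ∀ᶠ n in (U : Filter ℕ), ∃ (j : ℕ) (k : ι → ℤ),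
      ∀ i, |j * β n i - k i * a n i - τ i| ≤ κ := by
    have h1 : ∀ᶠ n in (U : Filter ℕ), ∀ i, a n i * η + |a n i - α i| * z i < κ := by
      rw [Filter.eventually_all]
      intro i
      have : Filter.Tendsto (fun n => a n i * η + |a n i - α i| * z i) (U : Filter ℕ)
          (nhds (α i * η + |α i - α i| * z i)) :=
        ((hα i).mul_const η).add ((((hα i).sub_const (α i)).abs).mul_const (z i))
      exact this.eventually (gt_mem_nhds (by simpa using hη i))
    have h2 : ∀ᶠ n in (U : Filter ℕ), ∀ i, α i = 0 → a n i < κ := by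
      rw [Filter.eventually_all]
      intro i
      by_cases h : α i = 0
      · filter_upwards [(hα i).eventually (gt_mem_nhds (by rw [h]; exact hκ0))] with n hn _ using hn
      · exact Filter.Eventually.of_forall fun n h' => absurd h' h
    filter_upwards [happrox η hη0, h1, h2] with n hn h1 h2
    obtain ⟨j, k, hjk⟩ := hn
    refine ⟨j, fun i => if α i = 0 then round ((j * β n i - σ) / a n i) else k i, fun i => ?_⟩
    have hpos := ha0 n i
    by_cases h : α i = 0
    · simp only [hτ, h, if_true]
      have h3 := abs_sub_round ((j * β n i - σ) / a n i)
      have h4 : j * β n i - (round ((j * β n i - σ) / a n i) : ℝ) * a n i - σ =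
          ((j * β n i - σ) / a n i - round ((j * β n i - σ) / a n i)) * a n i := by
        field_simp
        ring
      rw [h4, abs_mul, abs_of_pos hpos]
      nlinarith [h2 i h]
    · simp only [hτ, h, if_false]
      have h4 : j * β n i - k i * a n i - α i * z i =
          a n i * (j * (β n i / a n i) - k i - z i) + (a n i - α i) * z i := by
        field_simp
        ring
      rw [h4]
      refine (abs_add_le _ _).trans ?_
      rw [abs_mul, abs_mul, abs_of_pos hpos, abs_of_pos (hz0 i)]
      have := mul_le_mul_of_nonneg_left (hjk i).le hpos.le
      linarith [h1 i]
  have hsmall : ∀ᶠ n : ℕ in (U : Filter ℕ), 1 / ((n : ℝ) + 1) < κ :=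
    (tendsto_one_div_add_atTop_nhds_zero_nat.eventually (gt_mem_nhds hκ0)).filter_mono hUtop
  obtain ⟨n, ⟨j, k, hjk⟩, hn⟩ := (hclose.and hsmall).exists
  have h1 : ∑ i, (j * β n i - k i * a n i) ≤ ∑ i, (τ i + κ) :=
    Finset.sum_le_sum fun i _ => by linarith [(abs_le.1 (hjk i)).2]
  have h2 : ∑ i, (τ i + κ) = ∑ i, τ i + N * κ := by simp [Finset.sum_add_distrib, hN]
  have h3 := hbad n j k fun i => by linarith [(abs_le.1 (hjk i)).1, hκτ i]
  linarith

/-- A version of `exists_uniform_depth` for all index types of bounded cardinality. -/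
lemma exists_uniform_depth_of_card_le (N : ℕ) {A : Set ℝ} (hA : A ⊆ Set.Ioi 0)
    (hACC : ACCSet A) :
    ∃ δ : ℝ, 0 < δ ∧ ∀ (ι : Type) [Fintype ι], Fintype.card ι ≤ N →
      ∀ a β : ι → ℝ, (∀ i, a i ∈ A) → (∀ i, 0 < β i) → ∑ i, β i < 1 →
      ∃ (j : ℕ) (k : ι → ℤ), (∀ i, δ ≤ j * β i - k i * a i) ∧
        ∑ i, (j * β i - k i * a i) ≤ 1 - δ := by
  choose δ hδ0 hδ using fun n : ℕ => exists_uniform_depth (Fin n) hA hACC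
  obtain ⟨n₀, -, hmin⟩ := Finset.exists_min_image (Finset.range (N + 1)) δ ⟨0, by simp⟩
  refine ⟨δ n₀, hδ0 n₀, fun ι _ hι a β ha hβ hβ1 => ?_⟩
  have hle : δ n₀ ≤ δ (Fintype.card ι) := hmin _ (by simp; omega)
  let e := (Fintype.equivFin ι).symm
  obtain ⟨j, k, h1, h2⟩ := hδ (Fintype.card ι) (a ∘ e) (β ∘ e) (fun i => ha _) (fun i => hβ _)
    (by rwa [← Equiv.sum_comp e] at hβ1)
  refine ⟨j, k ∘ e.symm, fun i => ?_, ?_⟩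
  · have := h1 (e.symm i)
    simp only [Function.comp_apply, Equiv.apply_symm_apply] at this ⊢
    linarith
  · rw [← Equiv.sum_comp e]
    simp only [Function.comp_apply, Equiv.symm_apply_apply] at h2 ⊢
    linarith

lemma mem_intLat_iff {d : ℕ} {x : Fin d → ℝ} :
    x ∈ intLat d ↔ ∃ z : Fin d → ℤ, x = fun i => (z i : ℝ) := by
  constructor
  · intro h
    choose z hz using h
    exact ⟨z, funext hz⟩
  · rintro ⟨z, rfl⟩ i
    exact ⟨z i, rfl⟩

/-- The projection of the lattice along a nonzero lattice vector. -/
lemma exists_lattice_projection {d : ℕ} {u : Fin (d + 1) → ℤ} (hu : u ≠ 0) :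
    ∃ (π : (Fin (d + 1) → ℝ) →ₗ[ℝ] (Fin d → ℝ)) (u' : Fin (d + 1) → ℤ) (c : ℤ),
      Function.Surjective π ∧ π '' intLat (d + 1) = intLat d ∧ c ≠ 0 ∧ u = c • u' ∧
      ∀ x, π x = 0 → ∃ s : ℝ, x = s • fun i => (u' i : ℝ) := by
  classical
  obtain ⟨n, S⟩ := Submodule.smithNormalForm (Pi.basisFun ℤ (Fin (d + 1)))
    (Submodule.span ℤ {u})
  have hn : n = 1 := by
    have h1 := Module.finrank_eq_card_basis S.bN
    have h2 := (LinearEquiv.toSpanNonzeroSingleton ℤ _ u hu).finrank_eq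
    rw [Module.finrank_self] at h2
    simpa [← h2] using h1.symm
  subst hn
  set i₀ := S.f 0 with hi₀
  have hudiv : ∃ c : ℤ, u = c • S.bM i₀ := by
    have h := S.bN.sum_repr ⟨u, Submodule.mem_span_singleton_self u⟩
    rw [Fin.sum_univ_one] at h
    have h' := congrArg Subtype.val h
    rw [Submodule.coe_smul, S.snf 0, smul_smul] at h'
    exact ⟨_, h'.symm⟩
  obtain ⟨c, hc⟩ := hudiv
  let E : (Fin (d + 1) → ℤ) ≃ₗ[ℤ] (Fin (d + 1) → ℤ) := S.bM.equivFun
  let P := (LinearMap.toMatrix' E.toLinearMap).map (Int.castRingHom ℝ)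
  let Q := (LinearMap.toMatrix' E.symm.toLinearMap).map (Int.castRingHom ℝ)
  have hmap : ∀ (M : Matrix (Fin (d + 1)) (Fin (d + 1)) ℤ) (x : Fin (d + 1) → ℤ),
      (M.map (Int.castRingHom ℝ)).mulVec (fun i => (x i : ℝ)) =
        fun i => ((M.mulVec x i : ℤ) : ℝ) := by
    intro M x
    ext i
    simp [Matrix.mulVec, dotProduct]
  have hPx : ∀ x : Fin (d + 1) → ℤ, P.mulVec (fun i => (x i : ℝ)) =
      fun i => ((E x i : ℤ) : ℝ) := by
    intro x
    rw [hmap, ← Matrix.toLin'_apply, Matrix.toLin'_toMatrix']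
    rfl
  have hQx : ∀ x : Fin (d + 1) → ℤ, Q.mulVec (fun i => (x i : ℝ)) =
      fun i => ((E.symm x i : ℤ) : ℝ) := by
    intro x
    rw [hmap, ← Matrix.toLin'_apply, Matrix.toLin'_toMatrix']
    rfl
  have hPQ : P * Q = 1 := by
    rw [← Matrix.map_mul, ← LinearMap.toMatrix'_comp]
    simp
  have hQP : Q * P = 1 := by
    rw [← Matrix.map_mul, ← LinearMap.toMatrix'_comp]
    simp
  let π : (Fin (d + 1) → ℝ) →ₗ[ℝ] (Fin d → ℝ) :=
    (LinearMap.funLeft ℝ ℝ i₀.succAbove).comp (Matrix.toLin' P)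
  have hπ : ∀ x i, π x i = P.mulVec x (i₀.succAbove i) := fun x i => rfl
  refine ⟨π, S.bM i₀, c, ?_, ?_, ?_, hc, ?_⟩
  · intro w
    refine ⟨Q.mulVec (i₀.insertNth 0 w), ?_⟩
    ext i
    rw [hπ, Matrix.mulVec_mulVec, hPQ, Matrix.one_mulVec, Fin.insertNth_apply_succAbove]
  · ext w
    simp only [Set.mem_image, mem_intLat_iff]
    constructor
    · rintro ⟨_, ⟨x, rfl⟩, rfl⟩
      refine ⟨fun i => E x (i₀.succAbove i), ?_⟩
      ext i
      rw [hπ, hPx]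
    · rintro ⟨w, rfl⟩
      refine ⟨_, ⟨E.symm (i₀.insertNth 0 w), rfl⟩, ?_⟩
      ext i
      rw [hπ, hPx, E.apply_symm_apply]
      simp only [Fin.insertNth_apply_succAbove]
  · rintro rfl
    exact hu (by rw [hc, zero_smul])
  · intro x hx
    refine ⟨P.mulVec x i₀, ?_⟩
    have h1 : P.mulVec x = P.mulVec x i₀ • fun i => ((Pi.single i₀ 1 : Fin (d + 1) → ℤ) i : ℝ) := by
      ext i
      rcases Fin.eq_self_or_eq_succAbove i₀ i with rfl | ⟨k, rfl⟩
      · simp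
      · have := congrFun hx k
        rw [hπ] at this
        rw [this]
        simp
    have h2 : E.symm (Pi.single i₀ 1) = S.bM i₀ := by
      rw [LinearEquiv.symm_apply_eq]
      ext i
      simp [E, Pi.single_apply, eq_comm]
    calc x = Q.mulVec (P.mulVec x) := by rw [Matrix.mulVec_mulVec, hQP, Matrix.one_mulVec]
      _ = _ := by
        conv_lhs => rw [h1]
        rw [Matrix.mulVec_smul, hQx, h2]

section Convex

variable {E : Type} [NormedAddCommGroup E] [NormedSpace ℝ E]

/-- Interior points of the image of a convex body lift to interior points. -/
lemma Convex.exists_mem_interior_of_mem_interior_image {E' : Type*} [NormedAddCommGroup E']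
    [NormedSpace ℝ E'] {K : Set E} (hK : Convex ℝ K) (hne : (interior K).Nonempty)
    (π : E →ₗ[ℝ] E') {w : E'} (hw : w ∈ interior (π '' K)) : ∃ y ∈ interior K, π y = w := by
  obtain ⟨y₀, hy₀⟩ := hne
  have hcont : Filter.Tendsto (fun s : ℝ => w + s • (w - π y₀)) (nhds 0) (nhds w) := by
    have : Continuous fun s : ℝ => w + s • (w - π y₀) := by fun_prop
    simpa using this.tendsto 0
  have hev := (hcont.eventually (mem_interior_iff_mem_nhds.1 hw)).filter_mono
    (nhdsWithin_le_nhds (s := Set.Ioi 0))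
  obtain ⟨s, ⟨y', hy', hs⟩, hs0⟩ := (hev.and self_mem_nhdsWithin).exists
  have hs0 : 0 < s := hs0
  refine ⟨(s / (1 + s)) • y₀ + (1 / (1 + s)) • y', hK.combo_interior_self_mem_interior hy₀ hy'
    (by positivity) (by positivity) (by field_simp; ring), ?_⟩
  rw [map_add, map_smul, map_smul, hs, smul_add, smul_smul, smul_sub, add_comm, add_assoc,
    ← sub_eq_zero]
  have e1 : 1 / (1 + s) * s = s / (1 + s) := by ring
  rw [e1, sub_add_cancel, ← add_smul, show 1 / (1 + s) + s / (1 + s) = 1 by field_simp, one_smul,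
    sub_self]

/-- Positive combinations, of total weight less than one, of a spanning family of a convex set
containing the origin are interior points. -/
lemma Convex.sum_smul_mem_interior [FiniteDimensional ℝ E] {K : Set E} (hK : Convex ℝ K)
    (h0 : (0 : E) ∈ K) {ι : Type*} [Fintype ι] {v : ι → E} (hv : ∀ i, v i ∈ K)
    (hspan : Submodule.span ℝ (Set.range v) = ⊤) {c : ι → ℝ} (hc : ∀ i, 0 < c i)
    (hc1 : ∑ i, c i < 1) : ∑ i, c i • v i ∈ interior K := by
  let T : Set (ι → ℝ) := Set.univ.pi (fun _ => Set.Ioi 0) ∩ {c | ∑ i, c i < 1}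
  have hsum : Continuous fun c : ι → ℝ => ∑ i, c i := by fun_prop
  have hT : IsOpen T := (isOpen_set_pi Set.finite_univ fun _ _ => isOpen_Ioi).inter
    (isOpen_lt hsum continuous_const)
  let f := Fintype.linearCombination ℝ v
  have hf : Function.Surjective f := by
    rw [← LinearMap.range_eq_top, Fintype.range_linearCombination, hspan]
  have hopen := f.isOpenMap_of_finiteDimensional hf T hT
  refine interior_maximal ?_ hopen ⟨c, ⟨fun i _ => hc i, hc1⟩, by simp [f, Fintype.linearCombination_apply]⟩
  rintro _ ⟨c, ⟨hc, hc1⟩, rfl⟩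
  have h := hK.sum_mem (t := Finset.univ) (w := fun o : Option ι => o.elim (1 - ∑ i, c i) c)
    (z := fun o : Option ι => o.elim 0 v) (by
      rintro (_ | i) _
      · simpa using le_of_lt hc1
      · exact (Set.mem_Ioi.1 (hc i trivial)).le) (by simp [Fintype.sum_option]) (by
      rintro (_ | i) _
      · exact h0
      · exact hv i)
  simpa [Fintype.sum_option, f, Fintype.linearCombination_apply] using h

lemma exists_pos_combination_of_mem_convexHull [FiniteDimensional ℝ E] {F : Set E} {x : E}
    (hx : x ∈ convexHull ℝ F) :
    ∃ (ι : Type) (_ : Fintype ι) (v : ι → E) (w : ι → ℝ),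
      Fintype.card ι ≤ Module.finrank ℝ E + 1 ∧ (∀ i, v i ∈ F) ∧ (∀ i, 0 < w i) ∧
      ∑ i, w i = 1 ∧ ∑ i, w i • v i = x := by
  obtain ⟨ι, _, v, w, hv, haff, hw, hw1, hx⟩ := eq_pos_convex_span_of_mem_convexHull hx
  refine ⟨ι, inferInstance, v, w, haff.card_le_finrank_succ.trans ?_,
    fun i => hv ⟨i, rfl⟩, hw, hw1, hx⟩
  exact Nat.succ_le_succ (Submodule.finrank_le _)

/-- An interior point of a convex hull is a positive combination in which a given finite
family occurs with positive coefficients. -/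
lemma exists_pos_combination_of_mem_interior [FiniteDimensional ℝ E] {F : Set E} {y : E}
    (hy : y ∈ interior (convexHull ℝ F)) {κ : Type} [Fintype κ] (v : κ → E) :
    ∃ (ι : Type) (_ : Fintype ι) (v' : ι → E) (β : κ ⊕ ι → ℝ),
      Fintype.card ι ≤ Module.finrank ℝ E + 1 ∧ (∀ i, v' i ∈ F) ∧ (∀ i, 0 < β i) ∧
      ∑ i, β i < 1 ∧ ∑ i, β i • Sum.elim v v' i = y := by
  set N : ℝ := (Fintype.card κ : ℝ) with hN
  have hN0 : 0 ≤ N := by positivity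
  set V : E := ∑ i, v i with hV
  have hcont : Filter.Tendsto (fun s : ℝ => (1 - (N + 1) * s)⁻¹ • (y - s • V))
      (nhds 0) (nhds y) := by
    have : ContinuousAt (fun s : ℝ => (1 - (N + 1) * s)⁻¹ • (y - s • V)) 0 := by
      refine ContinuousAt.smul (ContinuousAt.inv₀ (by fun_prop) (by simp)) (by fun_prop)
    simpa using this.tendsto
  have hlt : ∀ᶠ s in nhds (0 : ℝ), (N + 1) * s < 1 := by
    have : Filter.Tendsto (fun s : ℝ => (N + 1) * s) (nhds 0) (nhds ((N + 1) * 0)) :=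
      Filter.tendsto_id.const_mul _
    exact this.eventually (gt_mem_nhds (by simp))
  obtain ⟨s, ⟨hmem, hs1⟩, hs0⟩ :=
    ((((hcont.eventually (mem_interior_iff_mem_nhds.1 hy)).and hlt).filter_mono
      (nhdsWithin_le_nhds (s := Set.Ioi 0))).and self_mem_nhdsWithin).exists
  have hs0 : 0 < s := hs0
  obtain ⟨ι, _, v', w, hcard, hv', hw, hw1, hsum⟩ := exists_pos_combination_of_mem_convexHull hmem
  refine ⟨ι, inferInstance, v', Sum.elim (fun _ => s) fun i => (1 - (N + 1) * s) * w i, hcard,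
    hv', ?_, ?_, ?_⟩
  · rintro (i | i)
    · exact hs0
    · exact mul_pos (by linarith) (hw i)
  · simp only [Fintype.sum_sum_type, Sum.elim_inl, Sum.elim_inr, Finset.sum_const, nsmul_eq_mul,
      Finset.card_univ, ← Finset.mul_sum, hw1, ← hN]
    linarith
  · simp only [Fintype.sum_sum_type, Sum.elim_inl, Sum.elim_inr, mul_smul, ← Finset.smul_sum,
      hsum, ← hV]
    rw [smul_smul, mul_inv_cancel₀ (by linarith), one_smul, add_sub_cancel]

end Convex

/-- The projection of a lattice-free polytope along a lattice direction in which it is very long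
is lattice-free. -/
theorem interior_image_inter_intLat_eq_empty {d p : ℕ} {A : Set ℝ} {δ : ℝ}
    (hA : A ⊆ Set.Ioi 0)
    (hδ : ∀ (ι : Type) [Fintype ι], Fintype.card ι ≤ 4 * (d + 1) →
      ∀ a β : ι → ℝ, (∀ i, a i ∈ A) → (∀ i, 0 < β i) → ∑ i, β i < 1 →
      ∃ (j : ℕ) (k : ι → ℤ), (∀ i, δ ≤ j * β i - k i * a i) ∧
        ∑ i, (j * β i - k i * a i) ≤ 1 - δ)
    {F : Set (Fin d → ℝ)} (hne : (interior (convexHull ℝ F)).Nonempty)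
    (hfree : intLat d ∩ interior (convexHull ℝ F) = ∅) (h0 : (0 : Fin d → ℝ) ∈ convexHull ℝ F)
    (hF : ∀ v ∈ F, ∃ (e : Fin d → ℤ) (a : ℝ), a ∈ A ∧ v = (1 / a) • fun i => (e i : ℝ))
    (π : (Fin d → ℝ) →ₗ[ℝ] (Fin p → ℝ)) (hπ : π '' intLat d = intLat p) (u : Fin d → ℤ)
    (hker : ∀ x, π x = 0 → ∃ s : ℝ, x = s • fun i => (u i : ℝ))
    {t : ℝ} (ht : 2 * |t| < δ) {P Q : Fin d → ℝ} (hP : P ∈ convexHull ℝ F)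
    (hQ : Q ∈ convexHull ℝ F) (hu : (fun i => (u i : ℝ)) = t • (P - Q)) :
    intLat p ∩ interior (π '' convexHull ℝ F) = ∅ := by
  set K := convexHull ℝ F with hKF
  have hK : Convex ℝ K := convex_convexHull ℝ F
  by_contra hcon
  obtain ⟨w, hwL, hwK⟩ := Set.nonempty_iff_ne_empty.2 hcon
  obtain ⟨x₀, hx₀, rfl⟩ : w ∈ π '' intLat d := hπ ▸ hwL
  obtain ⟨X₀, rfl⟩ := mem_intLat_iff.1 hx₀
  obtain ⟨y, hyK, hyw⟩ := hK.exists_mem_interior_of_mem_interior_image hne π hwK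
  obtain ⟨s, hs⟩ := hker (y - fun i => (X₀ i : ℝ)) (by rw [map_sub, hyw, sub_self])
  have hfin : Module.finrank ℝ (Fin d → ℝ) = d := by simp
  have hspanF : Submodule.span ℝ F = ⊤ := by
    apply Submodule.eq_top_of_nonempty_interior'
    exact hne.mono (interior_mono (convexHull_min Submodule.subset_span
      (Submodule.convex _)))
  obtain ⟨B, hBF, hBspan, hBlin⟩ := exists_linearIndependent ℝ F
  have : Fintype B := hBlin.setFinite.fintype
  have hBcard : Fintype.card B ≤ d := hBlin.fintype_card_le_finrank.trans_eq hfin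
  obtain ⟨ιP, _, vP, wP, hcP, hvP, hwP, hwP1, hPsum⟩ := exists_pos_combination_of_mem_convexHull hP
  obtain ⟨ιQ, _, vQ, wQ, hcQ, hvQ, hwQ, hwQ1, hQsum⟩ := exists_pos_combination_of_mem_convexHull hQ
  let v₁ : B ⊕ ιP ⊕ ιQ → Fin d → ℝ := Sum.elim Subtype.val (Sum.elim vP vQ)
  obtain ⟨ιY, _, vY, β, hcY, hvY, hβ, hβ1, hysum⟩ := exists_pos_combination_of_mem_interior hyK v₁
  set v := Sum.elim v₁ vY with hv
  have hvF : ∀ i, v i ∈ F := by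
    rintro ((b | i | i) | i)
    · exact hBF b.2
    · exact hvP i
    · exact hvQ i
    · exact hvY i
  have hvspan : Submodule.span ℝ (Set.range v) = ⊤ := by
    rw [eq_top_iff, ← hspanF, ← hBspan]
    exact Submodule.span_mono fun b hb => ⟨Sum.inl (Sum.inl ⟨b, hb⟩), rfl⟩
  let γ : (B ⊕ ιP ⊕ ιQ) ⊕ ιY → ℝ :=
    Sum.elim (Sum.elim (fun _ => 0) (Sum.elim (fun i => t * wP i) fun i => -(t * wQ i)))
      fun _ => 0
  have hγsum : ∑ i, γ i • v i = fun i => (u i : ℝ) := by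
    rw [hu, ← hPsum, ← hQsum]
    simp [γ, v, v₁, mul_smul, Finset.smul_sum, sub_eq_add_neg]
  have hγ1 : ∑ i, |γ i| = 2 * |t| := by
    have e1 : ∀ i, |wP i| = wP i := fun i => abs_of_pos (hwP i)
    have e2 : ∀ i, |wQ i| = wQ i := fun i => abs_of_pos (hwQ i)
    simp [γ, abs_mul, e1, e2, ← Finset.mul_sum, hwP1, hwQ1]
    ring
  choose e a haA hve using fun i => hF (v i) (hvF i)
  have hcard : Fintype.card ((B ⊕ ιP ⊕ ιQ) ⊕ ιY) ≤ 4 * (d + 1) := by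
    simp only [Fintype.card_sum]
    omega
  obtain ⟨j, k, hjk, hjk1⟩ := hδ _ hcard a β haA hβ hβ1
  set m : ℤ := round (j * s) with hm
  set θ : ℝ := m - j * s with hθ
  have hθ1 : |θ| ≤ 1 := by
    have := abs_sub_round ((j : ℝ) * s)
    rw [hθ, abs_sub_comm]
    linarith
  have hθγ : ∀ i, |θ * γ i| ≤ |γ i| := fun i => by
    rw [abs_mul]
    exact mul_le_of_le_one_left (abs_nonneg _) hθ1
  set c : (B ⊕ ιP ⊕ ιQ) ⊕ ιY → ℝ := fun i => (j * β i - k i * a i) + θ * γ i with hc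
  have hc0 : ∀ i, 0 < c i := by
    intro i
    have h1 : |γ i| ≤ ∑ i, |γ i| :=
      Finset.single_le_sum (fun i _ => abs_nonneg (γ i)) (Finset.mem_univ i)
    have h2 := (abs_le.1 (hθγ i)).1
    have h3 := hjk i
    simp only [hc]
    linarith
  have hc1 : ∑ i, c i < 1 := by
    have h1 : ∑ i, θ * γ i ≤ ∑ i, |γ i| :=
      Finset.sum_le_sum fun i _ => (le_abs_self _).trans (hθγ i)
    rw [hc, Finset.sum_add_distrib]
    linarith
  have hint : ∑ i, c i • v i ∈ interior K :=
    hK.sum_smul_mem_interior h0 (fun i => subset_convexHull ℝ F (hvF i)) hvspan hc0 hc1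
  have hkv : ∀ i, (k i * a i) • v i = fun l => ((k i * e i l : ℤ) : ℝ) := by
    intro i
    have hai : a i ≠ 0 := ne_of_gt (hA (haA i))
    rw [hve i]
    ext l
    simp only [Pi.smul_apply, smul_eq_mul]
    push_cast
    field_simp
  have hlat : ∑ i, c i • v i = fun l => ((j * X₀ l + m * u l - ∑ i, k i * e i l : ℤ) : ℝ) := by
    have h1 : ∑ i, c i • v i = (j : ℝ) • y + θ • (fun i => (u i : ℝ))
        - ∑ i, (k i * a i) • v i := by
      rw [← hysum, ← hγsum, Finset.smul_sum, Finset.smul_sum, ← Finset.sum_add_distrib,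
        ← Finset.sum_sub_distrib]
      refine Finset.sum_congr rfl fun i _ => ?_
      simp only [hc, add_smul, sub_smul, mul_smul]
      abel
    rw [h1, eq_add_of_sub_eq hs]
    simp only [hkv]
    ext l
    simp only [Pi.sub_apply, Pi.add_apply, Pi.smul_apply, smul_eq_mul, Finset.sum_apply, hθ]
    push_cast
    ring
  have : ∑ i, c i • v i ∈ intLat d ∩ interior K := ⟨mem_intLat_iff.2 ⟨_, hlat⟩, hint⟩
  rw [hfree] at this
  exact this

lemma ACCSet.insert {A : Set ℝ} (hA : ACCSet A) (b : ℝ) : ACCSet (insert b A) := by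
  rintro ⟨f, hf, hfA⟩
  by_cases h : ∃ n, f n = b
  · obtain ⟨n, rfl⟩ := h
    refine hA ⟨fun k => f (n + 1 + k), fun i j hij => hf (by omega), fun k => ?_⟩
    refine (hfA (n + 1 + k)).resolve_left fun h => ?_
    have := hf.injective h
    omega
  · push Not at h
    exact hA ⟨f, hf, fun n => (hfA n).resolve_left (h n)⟩

/-- Projecting repeatedly along short lattice vectors of `K - K` keeps `K` lattice-free. -/
theorem exists_projection_of_generators {A : Set ℝ} (hA : A ⊆ Set.Ioi 0) (hACC : ACCSet A)
    (d : ℕ) :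
    ∃ ε : ℝ, 0 < ε ∧ ∀ F : Set (Fin d → ℝ),
      (interior (convexHull ℝ F)).Nonempty →
      intLat d ∩ interior (convexHull ℝ F) = ∅ →
      (0 : Fin d → ℝ) ∈ convexHull ℝ F →
      (∀ v ∈ F, ∃ (e : Fin d → ℤ) (a : ℝ), a ∈ A ∧ v = (1 / a) • fun i => (e i : ℝ)) →
      ∃ p : ℕ, 1 ≤ p ∧ p ≤ d ∧
        ∃ π : (Fin d → ℝ) →ₗ[ℝ] (Fin p → ℝ), Function.Surjective π ∧
          π '' intLat d = intLat p ∧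
          intLat p ∩ interior (π '' convexHull ℝ F) = ∅ ∧
          ∀ v ∈ intLat p, v ≠ 0 → ∀ t : ℝ, 0 < t → t < ε →
            v ∉ t • (π '' convexHull ℝ F - π '' convexHull ℝ F) := by
  induction d with
  | zero =>
    refine ⟨1, one_pos, fun F ⟨x, hx⟩ hfree _ _ => ?_⟩
    have : x ∈ intLat 0 ∩ interior (convexHull ℝ F) := ⟨fun i => i.elim0, hx⟩
    rw [hfree] at this
    exact this.elim
  | succ d ih =>
    obtain ⟨ε, hε0, hε⟩ := ih
    obtain ⟨δ, hδ0, hδ⟩ := exists_uniform_depth_of_card_le (4 * (d + 1 + 1)) hA hACC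
    refine ⟨min ε (δ / 2), by positivity, fun F hne hfree h0 hF => ?_⟩
    set K := convexHull ℝ F with hK
    by_cases hshort : ∀ v ∈ intLat (d + 1), v ≠ 0 → ∀ t : ℝ, 0 < t → t < min ε (δ / 2) →
        v ∉ t • (K - K)
    · exact ⟨d + 1, by omega, le_rfl, LinearMap.id, Function.surjective_id, by simp,
        by simpa using hfree, by simpa using hshort⟩
    push Not at hshort
    obtain ⟨v, hv, hv0, t, ht0, ht, hvt⟩ := hshort
    obtain ⟨u, rfl⟩ := mem_intLat_iff.1 hv
    obtain ⟨_, ⟨P, hP, Q, hQ, rfl⟩, hPQ⟩ := Set.mem_smul_set.1 hvt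
    have hu0 : u ≠ 0 := by
      rintro rfl
      exact hv0 (by ext; simp)
    obtain ⟨π, u', c, hsurj, hlat, hc0, rfl, hker⟩ := exists_lattice_projection hu0
    have hc0' : (c : ℝ) ≠ 0 := by exact_mod_cast hc0
    have hu' : (fun i => (u' i : ℝ)) = (t / c) • (P - Q) := by
      rw [div_eq_inv_mul, mul_smul]
      dsimp only at hPQ
      rw [hPQ]
      ext i
      simp [hc0']
    have hc1 : (1 : ℝ) ≤ |(c : ℝ)| := by exact_mod_cast Int.one_le_abs hc0
    have hsmall : 2 * |t / c| < δ := by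
      have h1 : |t / c| ≤ t := by
        rw [abs_div, abs_of_pos ht0]
        exact div_le_self ht0.le hc1
      linarith [ht.trans_le (min_le_right _ _)]
    have hfree' := interior_image_inter_intLat_eq_empty hA hδ hne hfree h0 hF π hlat u' hker
      hsmall hP hQ hu'
    have himage : π '' K = convexHull ℝ (π '' F) := π.image_convexHull F
    obtain ⟨p, hp1, hpd, ρ, hρsurj, hρlat, hρfree, hρ⟩ := hε (π '' F) (by
        rw [← himage]
        exact (hne.image π).mono
          ((π.isOpenMap_of_finiteDimensional hsurj).image_interior_subset K))
      (by rwa [← himage]) (by rw [← himage]; exact ⟨0, h0, map_zero π⟩) (by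
        rintro _ ⟨v, hv, rfl⟩
        obtain ⟨e, a, ha, rfl⟩ := hF v hv
        have : π (fun i => (e i : ℝ)) ∈ intLat d := by
          rw [← hlat]
          exact ⟨_, mem_intLat_iff.2 ⟨e, rfl⟩, rfl⟩
        obtain ⟨e', he'⟩ := mem_intLat_iff.1 this
        exact ⟨e', a, ha, by rw [map_smul, he']⟩)
    have hcomp : (ρ ∘ₗ π) '' K = ρ '' convexHull ℝ (π '' F) := by
      rw [LinearMap.coe_comp, Set.image_comp, himage]
    refine ⟨p, hp1, by omega, ρ ∘ₗ π, hρsurj.comp hsurj, ?_, ?_, ?_⟩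
    · rw [LinearMap.coe_comp, Set.image_comp, hlat, hρlat]
    · rw [hcomp, hρfree]
    · intro v hv hv0 t ht0 ht
      rw [hcomp]
      exact hρ v hv hv0 t ht0 (ht.trans_le (min_le_left _ _))

/-- **generalized Nill–Ziegler theorem.** Fix `d ≥ 1` and an ACC set
`A ⊆ (0, ∞)`. There exists `ε > 0` such that every compact polytope `□ = conv F ⊆ ℝ^d` with
nonempty interior, no lattice point in its interior, `0 ∈ □`, and all nonzero extremal points
of the form `(1/a) • e` (`e ∈ ℤ^d` primitive, `a ∈ A`), admits a surjective linear
`π : ℝ^d → ℝ^p` (`1 ≤ p ≤ d`) with `π(ℤ^d) = ℤ^p`, such that `□' = π(□)` has no lattice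
point in its interior and no nonzero lattice vector lies in `t • (□' - □')` for `0 < t < ε`.
-/
theorem stmt_11 (d : ℕ) (hd : 1 ≤ d) (A : Set ℝ) (hA : A ⊆ Set.Ioi 0) (hACC : ACCSet A) :
    ∃ ε : ℝ, 0 < ε ∧ ∀ (F : Finset (Fin d → ℝ)) (K : Set (Fin d → ℝ)),
      K = convexHull ℝ (F : Set (Fin d → ℝ)) →
      (interior K).Nonempty →
      intLat d ∩ interior K = ∅ →
      (0 : Fin d → ℝ) ∈ K →
      (∀ v ∈ Set.extremePoints ℝ K, v ≠ 0 →
        ∃ (e : Fin d → ℤ) (a : ℝ), Primitive e ∧ a ∈ A ∧ v = (1 / a) • fun i => (e i : ℝ)) →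
      ∃ p : ℕ, 1 ≤ p ∧ p ≤ d ∧
        ∃ π : (Fin d → ℝ) →ₗ[ℝ] (Fin p → ℝ), Function.Surjective π ∧
          π '' intLat d = intLat p ∧
          intLat p ∩ interior (π '' K) = ∅ ∧
          ∀ v ∈ intLat p, v ≠ 0 → ∀ t : ℝ, 0 < t → t < ε →
            v ∉ t • (π '' K - π '' K) := by
  have hA' : insert 1 A ⊆ Set.Ioi (0 : ℝ) := Set.insert_subset (by simp) hA
  obtain ⟨ε, hε0, hε⟩ := exists_projection_of_generators hA' (hACC.insert 1) d
  refine ⟨ε, hε0, fun F K hKF hne hfree h0 hext => ?_⟩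
  have hKc : IsCompact K := hKF ▸ F.finite_toSet.isCompact_convexHull ℝ
  have hKconv : Convex ℝ K := hKF ▸ convex_convexHull ℝ _
  have hfin : (Set.extremePoints ℝ K).Finite :=
    F.finite_toSet.subset (hKF ▸ extremePoints_convexHull_subset)
  have hK : K = convexHull ℝ (Set.extremePoints ℝ K) := by
    conv_lhs => rw [← closure_convexHull_extremePoints hKc hKconv]
    exact (hfin.isCompact_convexHull ℝ).isClosed.closure_eq
  have h := hε (Set.extremePoints ℝ K)
  rw [← hK] at h
  refine h hne hfree h0 fun v hv => ?_
  by_cases hv0 : v = 0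
  · exact ⟨0, 1, Set.mem_insert _ _, by ext i; simp [hv0]⟩
  · obtain ⟨e, a, -, ha, hva⟩ := hext v hv hv0
    exact ⟨e, a, Set.mem_insert_of_mem _ ha, hva⟩
end

section
/- Let d ≥ 2 and let □ ⊆ ℝ^d be a compact convex set with nonempty interior such that ℤ^d ∩ interior □ = ∅. Let τ > 0 and let b ∈ ℤ^d be primitive with b ∈ τ • (□ − □). Let π : ℝ^d → ℝ^{d−1} be a surjective linear map with ker π = ℝ • b and π(ℤ^d) = ℤ^{d−1}, and set □' = π(□). Then for every Q ∈ ℤ^{d−1} ∩ interior □', the coefficient of asymmetry satisfies γ(Q ∈ □') ≤ τ. -/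
open Pointwise

/-- A surjective linear map sends the interior of a convex set with nonempty interior onto a set
containing the interior of its image. -/
theorem Convex.interior_image_subset_image_interior {m n : ℕ} {K : Set (Fin m → ℝ)}
    (hconv : Convex ℝ K) (hne : (interior K).Nonempty)
    (π : (Fin m → ℝ) →ₗ[ℝ] (Fin n → ℝ)) (hπ : Function.Surjective π) :
    interior (π '' K) ⊆ π '' interior K := by
  have hcont : Continuous π := π.continuous_of_finiteDimensional
  have hopen : IsOpen (π '' interior K) :=
    π.isOpenMap_of_finiteDimensional hπ _ isOpen_interior
  have hsub : π '' K ⊆ closure (π '' interior K) := by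
    refine Set.Subset.trans (Set.image_mono ?_) (image_closure_subset_closure_image hcont)
    rw [hconv.closure_interior_eq_closure_of_nonempty_interior hne]
    exact subset_closure
  have hcl : interior (closure (π '' interior K)) = interior (π '' interior K) := by
    refine (hconv.interior.linear_image π).interior_closure_eq_interior_of_nonempty_interior ?_
    rw [hopen.interior_eq]
    exact hne.image π
  rw [← hopen.interior_eq, ← hcl]
  exact interior_mono hsub

/-- A scaling of `K - K` that fits around a point of a bounded non-subsingleton set `K` has
factor at most `1 / 2`. -/
theorem le_half_of_add_smul_sub_mem {E : Type*} [NormedAddCommGroup E] [NormedSpace ℝ E]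
    {K : Set E} (hK : Bornology.IsBounded K) (hnt : K.Nontrivial) {P : E} {t : ℝ} (ht : 0 ≤ t)
    (h : ∀ x ∈ K - K, P + t • x ∈ K) : t ≤ 1 / 2 := by
  have hpos : 0 < Metric.diam K := Metric.diam_pos hnt hK
  have hle : ∀ x ∈ K, ∀ y ∈ K, 2 * t * dist x y ≤ Metric.diam K := by
    intro x hx y hy
    have hd := Metric.dist_le_diam_of_mem hK (h _ (Set.sub_mem_sub hx hy))
      (h _ (Set.sub_mem_sub hy hx))
    have heq : P + t • (x - y) - (P + t • (y - x)) = (2 * t) • (x - y) := by module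
    rwa [dist_eq_norm, heq, norm_smul, Real.norm_of_nonneg (by positivity),
      ← dist_eq_norm] at hd
  by_contra! hlt
  have hdiam : Metric.diam K ≤ Metric.diam K / (2 * t) := by
    refine Metric.diam_le_of_forall_dist_le (by positivity) fun x hx y hy => ?_
    rw [le_div_iff₀ (by linarith)]
    linarith [hle x hx y hy]
  rw [le_div_iff₀ (by linarith)] at hdiam
  nlinarith

/-- If `x ↦ P + t • (x - R)` with `0 ≤ t < 1` preserves a complete set `K` containing `R`, then
`P` divides a segment from some point of `K` to `R` in ratio `t : 1 - t`. -/
theorem exists_mem_add_smul_eq {E : Type*} [NormedAddCommGroup E] [NormedSpace ℝ E]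
    {K : Set E} (hK : IsComplete K) {P R : E} {t : ℝ} (ht : 0 ≤ t) (ht1 : t < 1) (hR : R ∈ K)
    (h : ∀ x ∈ K, P + t • (x - R) ∈ K) : ∃ S ∈ K, (1 - t) • S + t • R = P := by
  have hmaps : Set.MapsTo (fun x => P + t • (x - R)) K K := h
  have hcontr : ContractingWith ⟨t, ht⟩ (hmaps.restrict _ K K) := by
    refine ⟨by exact_mod_cast ht1, LipschitzWith.of_dist_le_mul fun x y => le_of_eq ?_⟩
    have heq : P + t • ((x : E) - R) - (P + t • ((y : E) - R)) = t • ((x : E) - y) := by module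
    rw [Subtype.dist_eq, Subtype.dist_eq, Set.MapsTo.val_restrict_apply,
      Set.MapsTo.val_restrict_apply, dist_eq_norm, heq, norm_smul, Real.norm_of_nonneg ht,
      ← dist_eq_norm]
    rfl
  obtain ⟨S, hS, hfix, -⟩ := hcontr.exists_fixedPoint' hK hmaps hR (edist_ne_top _ _)
  refine ⟨S, hS, ?_⟩
  have hfix : P + t • (S - R) = S := hfix
  calc (1 - t) • S + t • R = S - t • (S - R) := by module
    _ = P := by nth_rewrite 1 [← hfix]; simp

/-- If the line `z + ℝ • v` meets the interior of a convex set `K` and contains a segment of `K`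
of length more than `1` in units of `v`, then some `z + n • v` with `n` an integer is interior
to `K`. -/
theorem Convex.exists_int_add_smul_mem_interior {E : Type*} [AddCommGroup E] [Module ℝ E]
    [TopologicalSpace E] [IsTopologicalAddGroup E] [ContinuousConstSMul ℝ E]
    {K : Set E} (hconv : Convex ℝ K) {z v : E} {r a c : ℝ} (hr : z + r • v ∈ interior K)
    (ha : z + a • v ∈ K) (hc : z + c • v ∈ K) (hac : a + 1 < c) :
    ∃ n : ℤ, z + (n : ℝ) • v ∈ interior K := by
  have key : ∀ s u : ℝ, z + s • v ∈ K → u ∈ openSegment ℝ r s → z + u • v ∈ interior K := by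
    rintro s u hs ⟨p, q, hp, hq, hpq, rfl⟩
    refine hconv.openSegment_interior_self_subset_interior hr hs ⟨p, q, hp, hq, hpq, ?_⟩
    obtain rfl : q = 1 - p := by linarith
    simp only [smul_eq_mul]
    module
  have h1 : a < (⌊a⌋ + 1 : ℤ) := by exact_mod_cast Int.lt_floor_add_one a
  have h2 : ((⌊a⌋ + 1 : ℤ) : ℝ) < c := by
    push_cast
    linarith [Int.floor_le a]
  refine ⟨⌊a⌋ + 1, ?_⟩
  rcases lt_trichotomy r (⌊a⌋ + 1 : ℤ) with hlt | heq | hgt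
  · exact key c _ hc (by rw [openSegment_eq_Ioo (hlt.trans h2)]; exact ⟨hlt, h2⟩)
  · rwa [← heq]
  · refine key a _ ha ?_
    rw [openSegment_symm, openSegment_eq_Ioo (h1.trans hgt)]
    exact ⟨h1, hgt⟩

/-- Let `d ≥ 2`, `□ ⊆ ℝ^d` compact convex with nonempty interior and no
lattice point in its interior. Let `τ > 0`, `b ∈ ℤ^d` primitive with `b ∈ τ • (□ - □)`, and
`π : ℝ^d → ℝ^{d-1}` surjective linear with `ker π = ℝ • b` and `π(ℤ^d) = ℤ^{d-1}`; set
`□' = π(□)`. Then `γ(Q ∈ □') ≤ τ` for every `Q ∈ ℤ^{d-1} ∩ int □'`. -/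
theorem stmt_12 (d : ℕ) (hd : 2 ≤ d) (K : Set (Fin d → ℝ))
    (hc : IsCompact K) (hconv : Convex ℝ K) (hne : (interior K).Nonempty)
    (hint : intLat d ∩ interior K = ∅)
    (τ : ℝ) (hτ : 0 < τ) (b : Fin d → ℤ) (hb : Primitive b)
    (hbτ : (fun i => (b i : ℝ)) ∈ τ • (K - K))
    (π : (Fin d → ℝ) →ₗ[ℝ] (Fin (d - 1) → ℝ)) (hπs : Function.Surjective π)
    (hker : LinearMap.ker π = Submodule.span ℝ {fun i => (b i : ℝ)})
    (hlat : π '' intLat d = intLat (d - 1)) :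
    ∀ Q ∈ intLat (d - 1) ∩ interior (π '' K), asym (π '' K) Q ≤ τ := by
  rintro Q ⟨hQlat, hQint⟩
  refine Real.sSup_le ?_ hτ.le
  rintro t ⟨ht0, ht⟩
  set v : Fin d → ℝ := fun i => (b i : ℝ) with hv
  have hcK : IsCompact (π '' K) := hc.image π.continuous_of_finiteDimensional
  have : Nonempty (Fin (d - 1)) := ⟨⟨0, by omega⟩⟩
  have hnt : (π '' K).Nontrivial := by
    by_contra hns
    obtain h | ⟨x, h⟩ := (Set.not_nontrivial_iff.mp hns).eq_empty_or_singleton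
    · simp [h] at hQint
    · simp [h] at hQint
  have ht1 : t < 1 := (le_half_of_add_smul_sub_mem hcK.isBounded hnt ht0 ht).trans_lt (by norm_num)
  by_contra! hlt
  obtain ⟨w, ⟨u, hu, u', hu', rfl⟩, hw⟩ := hbτ
  replace hw : τ • (u - u') = v := hw
  obtain ⟨S, ⟨s, hs, rfl⟩, hQ⟩ := exists_mem_add_smul_eq (R := π u') hcK.isComplete ht0 ht1
    (Set.mem_image_of_mem π hu')
    fun x hx => ht _ (Set.sub_mem_sub hx (Set.mem_image_of_mem π hu'))
  obtain ⟨p, hp, hpQ⟩ := hconv.interior_image_subset_image_interior hne π hπs hQint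
  obtain ⟨z, hz, hzQ⟩ : Q ∈ π '' intLat d := hlat ▸ hQlat
  have hfib : ∀ x, π x = Q → ∃ r : ℝ, x = z + r • v := by
    intro x hx
    have hmem : x - z ∈ LinearMap.ker π := by simp [hx, hzQ]
    rw [hker, Submodule.mem_span_singleton] at hmem
    obtain ⟨r, hr⟩ := hmem
    exact ⟨r, by rw [hr]; abel⟩
  obtain ⟨r, rfl⟩ := hfib p hpQ
  obtain ⟨a, ha⟩ := hfib ((1 - t) • s + t • u') (by simpa using hQ)
  have hu_eq : u = u' + τ⁻¹ • v := by
    rw [← hw, inv_smul_smul₀ hτ.ne']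
    abel
  have hc_eq : (1 - t) • s + t • u = z + (a + t * τ⁻¹) • v := by
    rw [add_smul, ← add_assoc, ← ha, hu_eq]
    module
  have hlen : 1 < t * τ⁻¹ := by rwa [← div_eq_mul_inv, one_lt_div hτ]
  obtain ⟨n, hn⟩ := hconv.exists_int_add_smul_mem_interior (a := a) (c := a + t * τ⁻¹) hp
    (ha ▸ hconv hs hu' (by linarith) ht0 (by ring))
    (hc_eq ▸ hconv hs hu (by linarith) ht0 (by ring)) (by linarith)
  refine (Set.eq_empty_iff_forall_notMem.mp hint) _ ⟨fun i => ?_, hn⟩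
  obtain ⟨k, hk⟩ := hz i
  exact ⟨k + n * b i, by simp [hk, hv]⟩
end

section
/- Let □ ⊆ ℝ^d be a closed convex set with 0 ∈ □. Define its polar set U = {e ∈ ℝ^d : ⟨m, e⟩ ≥ −1 for all m ∈ □} and the cone C = ⋃_{t ≥ 0} t • U. Then interior(U) = {e ∈ interior(C) : inf_{m ∈ □} ⟨m, e⟩ > −1}. -/
open Pointwise

/-- The cone over the polar set of `K` consists of the vectors whose pairing with `K` is
bounded below. -/
theorem exists_mem_smul_polar_iff {d : ℕ} {K : Set (Fin d → ℝ)} {x : Fin d → ℝ} :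
    (∃ t : ℝ, 0 ≤ t ∧ x ∈ t • {e : Fin d → ℝ | ∀ m ∈ K, -1 ≤ m ⬝ᵥ e}) ↔
      ∃ b : ℝ, ∀ m ∈ K, b ≤ m ⬝ᵥ x := by
  constructor
  · rintro ⟨t, ht, u, hu, rfl⟩
    refine ⟨-t, fun m hm => ?_⟩
    have := mul_le_mul_of_nonneg_left (hu m hm) ht
    simpa [dotProduct_smul] using this
  · rintro ⟨b, hb⟩
    have ht : 0 < |b| + 1 := by positivity
    refine ⟨|b| + 1, ht.le, (|b| + 1)⁻¹ • x, fun m hm => ?_, smul_inv_smul₀ ht.ne' x⟩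
    rw [dotProduct_smul, smul_eq_mul, inv_mul_eq_div, le_div_iff₀ ht]
    linarith [hb m hm, neg_abs_le b]

/-- The infimum of the pairing with `K` is concave where it is finite. -/
theorem concaveOn_iInf_dotProduct {d : ℕ} {K : Set (Fin d → ℝ)} (hK : K.Nonempty) :
    ConcaveOn ℝ {x : Fin d → ℝ | ∃ b : ℝ, ∀ m ∈ K, b ≤ m ⬝ᵥ x}
      (fun x => ⨅ m : K, (m : Fin d → ℝ) ⬝ᵥ x) := by
  have : Nonempty K := hK.to_subtype
  have bound {x y : Fin d → ℝ} {a b p q : ℝ} (ha : 0 ≤ a) (hb : 0 ≤ b)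
      (hp : ∀ m ∈ K, p ≤ m ⬝ᵥ x) (hq : ∀ m ∈ K, q ≤ m ⬝ᵥ y) :
      ∀ m ∈ K, a * p + b * q ≤ m ⬝ᵥ (a • x + b • y) := by
    intro m hm
    rw [dotProduct_add, dotProduct_smul, dotProduct_smul, smul_eq_mul, smul_eq_mul]
    gcongr
    exacts [hp m hm, hq m hm]
  have iInf_le {x : Fin d → ℝ} (hx : ∃ b : ℝ, ∀ m ∈ K, b ≤ m ⬝ᵥ x) :
      ∀ m ∈ K, ⨅ m : K, (m : Fin d → ℝ) ⬝ᵥ x ≤ m ⬝ᵥ x := by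
    obtain ⟨b, hb⟩ := hx
    exact fun m hm => ciInf_le (f := fun m : K => (m : Fin d → ℝ) ⬝ᵥ x)
      ⟨b, by rintro _ ⟨m, rfl⟩; exact hb m m.2⟩ ⟨m, hm⟩
  refine ⟨?_, fun x hx y hy a b ha hb _ => ?_⟩
  · rintro x ⟨p, hp⟩ y ⟨q, hq⟩ a b ha hb -
    exact ⟨_, bound ha hb hp hq⟩
  · exact le_ciInf fun m => bound ha hb (iInf_le hx) (iInf_le hy) m m.2

/-- Let `□ ⊆ ℝ^d` be closed convex with `0 ∈ □`, let
`U = {e : ⟨m, e⟩ ≥ -1 ∀ m ∈ □}` be its polar set, and `C = ⋃_{t ≥ 0} t • U`. Then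
`int U = {e ∈ int C : inf_{m ∈ □} ⟨m, e⟩ > -1}`. -/
theorem stmt_13 (d : ℕ) (K : Set (Fin d → ℝ)) (hcl : IsClosed K) (hconv : Convex ℝ K)
    (h0 : (0 : Fin d → ℝ) ∈ K)
    (U C : Set (Fin d → ℝ))
    (hU : U = {e | ∀ m ∈ K, -1 ≤ ∑ i, m i * e i})
    (hC : C = {x | ∃ t : ℝ, 0 ≤ t ∧ x ∈ t • U}) :
    interior U = {e | e ∈ interior C ∧ ∃ c : ℝ, -1 < c ∧ ∀ m ∈ K, c ≤ ∑ i, m i * e i} := by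
  have hC' : C = {x | ∃ b : ℝ, ∀ m ∈ K, b ≤ m ⬝ᵥ x} := by
    rw [hC, hU]
    ext x
    exact exists_mem_smul_polar_iff
  have : Nonempty K := ⟨⟨0, h0⟩⟩
  apply Set.Subset.antisymm
  · intro e he
    refine ⟨interior_mono (fun x hx => ?_) he, ?_⟩
    · rw [hC]
      exact ⟨1, zero_le_one, by simpa using hx⟩
    · have hcont : Continuous fun t : ℝ => t • e := by fun_prop
      have hnhds : ∀ᶠ t in nhds (1 : ℝ), t • e ∈ U :=
        hcont.continuousAt.eventually_mem (by simpa using mem_interior_iff_mem_nhds.1 he)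
      obtain ⟨t, htU, ht⟩ :=
        ((hnhds.filter_mono nhdsWithin_le_nhds).and
          (self_mem_nhdsWithin : Set.Ioi (1 : ℝ) ∈ nhdsWithin 1 (Set.Ioi 1))).exists
      have ht : 1 < t := ht
      have ht0 : 0 < t := by linarith
      refine ⟨-1 / t, by rw [lt_div_iff₀ ht0]; linarith, fun m hm => ?_⟩
      rw [hU] at htU
      have h : -1 ≤ m ⬝ᵥ (t • e) := htU m hm
      rw [dotProduct_smul, smul_eq_mul] at h
      rw [div_le_iff₀' ht0]
      exact h
  · rintro e ⟨heC, c, hc, hce⟩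
    have hcont := (concaveOn_iInf_dotProduct ⟨0, h0⟩ : ConcaveOn ℝ _ _).continuousOn_interior
    rw [← hC'] at hcont
    have hlt : -1 < ⨅ m : K, (m : Fin d → ℝ) ⬝ᵥ e :=
      hc.trans_le (le_ciInf fun m => hce m m.2)
    rw [mem_interior_iff_mem_nhds]
    filter_upwards [isOpen_interior.mem_nhds heC,
      (hcont.continuousAt (isOpen_interior.mem_nhds heC)).eventually (lt_mem_nhds hlt)]
      with x hxC hx
    have hxC := interior_subset hxC
    rw [hC'] at hxC
    obtain ⟨b, hb⟩ := hxC
    rw [hU]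
    exact fun m hm => hx.le.trans (ciInf_le (f := fun m : K => (m : Fin d → ℝ) ⬝ᵥ x)
      ⟨b, by rintro _ ⟨m, rfl⟩; exact hb m m.2⟩ ⟨m, hm⟩)
end
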